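/- arXiv:1408.0451 — 2 statements merged into one kernel-verified Lean document; each statement's English description precedes it below -/
import Mathlib

section
/- Let w be a nonempty finite word with heart v. Then w is a generalized trapezoidal word if and only if |w| + 2 = R_v + K_v + |Alph(w)|. -/
open List

variable {A : Type*} [DecidableEq A]

/-- The alphabet of a word: the finite set of distinct letters occurring in it. -/
def Alph (w : List A) : Finset A := w.toFinset

/-- The finset of all factors (contiguous subwords) of `w`. -/
def factors (w : List A) : Finset (List A) :=
  ((Finset.range (w.length + 1)) ×ˢ (Finset.range (w.length + 1))).image
    (fun p => (w.drop p.1).take p.2)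

/-- Factor complexity: the number of distinct factors of `w` of length `n`. -/
def C (w : List A) (n : ℕ) : ℕ := ((factors w).filter (fun u => u.length = n)).card

/-- Right-valence of `u` in `w`: the number of distinct letters `x` such that `u ++ [x]`
is a factor of `w`. -/
def rightValence (w u : List A) : ℕ := ((Alph w).filter (fun x => u ++ [x] <:+: w)).card

/-- `u` is a right special factor of `w`. -/
def RightSpecial (w u : List A) : Prop := u <:+: w ∧ 2 ≤ rightValence w u

/-- `R w`: the smallest positive integer `r` such that `w` has no right special factor
of length `r`. -/
noncomputable def R (w : List A) : ℕ :=
  sInf {r : ℕ | 0 < r ∧ ∀ u : List A, u.length = r → ¬ RightSpecial w u}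

/-- The number of occurrences of `u` as a factor of `w`. -/
def occCount (w u : List A) : ℕ :=
  ((Finset.range (w.length + 1)).filter
    (fun i => i + u.length ≤ w.length ∧ (w.drop i).take u.length = u)).card

/-- `K w`: the length of the shortest suffix of `w` occurring exactly once in `w`. -/
noncomputable def K (w : List A) : ℕ :=
  sInf {k : ℕ | ∃ u : List A, u <:+ w ∧ u.length = k ∧ occCount w u = 1}

/-- Left-valence of `u` in `w`. -/
def leftValence (w u : List A) : ℕ := ((Alph w).filter (fun x => x :: u <:+: w)).card

/-- `u` is a left special factor of `w`. -/
def LeftSpecial (w u : List A) : Prop := u <:+: w ∧ 2 ≤ leftValence w u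

/-- `L w`: the smallest positive integer `ℓ` such that `w` has no left special factor
of length `ℓ`. -/
noncomputable def L (w : List A) : ℕ :=
  sInf {r : ℕ | 0 < r ∧ ∀ u : List A, u.length = r → ¬ LeftSpecial w u}

/-- `H w`: the length of the shortest prefix of `w` occurring exactly once in `w`. -/
noncomputable def H (w : List A) : ℕ :=
  sInf {k : ℕ | ∃ u : List A, u <+: w ∧ u.length = k ∧ occCount w u = 1}

/-- A generalized trapezoidal word. -/
def IsGT (w : List A) : Prop :=
  w ≠ [] ∧ ((Alph w).card = 1 ∨
    ∃ m M : ℕ, 0 < m ∧ m ≤ M ∧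
      (∀ i, 1 ≤ i → i ≤ m → C w i = (Alph w).card + i - 1) ∧
      (∀ i, m ≤ i → i ≤ M - 1 → C w (i + 1) = C w i) ∧
      (∀ i, M ≤ i → i ≤ w.length → C w (i + 1) = C w i - 1))

/-- The heart of a word: remove the longest prefix and longest suffix consisting of
letters that occur exactly once in the word (if some letter repeats); otherwise the
word itself. -/
def heart (w : List A) : List A :=
  if ∀ x ∈ w, w.count x = 1 then w
  else
    ((w.dropWhile (fun x => w.count x == 1)).reverse.dropWhile
      (fun x => w.count x == 1)).reverse

/-- A word is rich if it has exactly `|w| + 1` distinct palindromic factors. -/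
def Rich (w : List A) : Prop :=
  ((factors w).filter (fun u => u.reverse = u)).card = w.length + 1

/-- `p` is a period of `w`. -/
def IsPeriod (w : List A) (p : ℕ) : Prop :=
  0 < p ∧ ∀ i : ℕ, i + p < w.length → w[i]? = w[i + p]?

/-- The minimal period of `w`. -/
noncomputable def minPeriod (w : List A) : ℕ := sInf {p : ℕ | IsPeriod w p}

set_option linter.unusedSectionVars false

/-- Factors of length `n`. -/
def Fac (w : List A) (n : ℕ) : Finset (List A) := (factors w).filter (fun u => u.length = n)

theorem mem_factors' (w u : List A) : u ∈ factors w ↔ u <:+: w := by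
  unfold factors
  simp only [Finset.mem_image, Finset.mem_product, Finset.mem_range, Prod.exists]
  constructor
  · rintro ⟨a, b, -, rfl⟩
    exact (List.take_prefix _ _).isInfix.trans (List.drop_suffix _ _).isInfix
  · rintro ⟨s, t, rfl⟩
    refine ⟨s.length, u.length, ⟨?_, ?_⟩, ?_⟩
    · simp only [List.length_append]; omega
    · simp only [List.length_append]; omega
    · simp

theorem mem_Fac (w u : List A) (n : ℕ) : u ∈ Fac w n ↔ u <:+: w ∧ u.length = n := by
  unfold Fac
  rw [Finset.mem_filter, mem_factors']

theorem C_eq (w : List A) (n : ℕ) : C w n = (Fac w n).card := rfl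

theorem mem_rext (w u : List A) (x : A) :
    x ∈ (Alph w).filter (fun x => u ++ [x] <:+: w) ↔ u ++ [x] <:+: w := by
  rw [Finset.mem_filter]
  refine ⟨fun h => h.2, fun h => ⟨?_, h⟩⟩
  unfold Alph
  rw [List.mem_toFinset]
  exact h.subset (by simp)

theorem two_le_rv (w u : List A) :
    2 ≤ rightValence w u ↔ ∃ x y, x ≠ y ∧ u ++ [x] <:+: w ∧ u ++ [y] <:+: w := by
  unfold rightValence
  rw [← Nat.lt_iff_add_one_le, Finset.one_lt_card]
  constructor
  · rintro ⟨a, ha, b, hb, hab⟩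
    exact ⟨a, b, hab, (mem_rext _ _ _).1 ha, (mem_rext _ _ _).1 hb⟩
  · rintro ⟨a, b, hab, ha, hb⟩
    exact ⟨a, (mem_rext _ _ _).2 ha, b, (mem_rext _ _ _).2 hb, hab⟩

theorem rv_eq_zero (w u : List A) : rightValence w u = 0 ↔ ∀ x, ¬ u ++ [x] <:+: w := by
  unfold rightValence
  rw [Finset.card_eq_zero, Finset.eq_empty_iff_forall_notMem]
  simp only [mem_rext]

theorem C_succ (w : List A) (n : ℕ) : C w (n + 1) = ∑ u ∈ Fac w n, rightValence w u := by
  rw [C_eq, Finset.card_eq_sum_card_fiberwise (f := List.dropLast) (t := Fac w n)]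
  · refine Finset.sum_congr rfl fun u hu => ?_
    unfold rightValence
    rw [← Finset.card_image_of_injective (f := fun x : A => u ++ [x])
      ((Alph w).filter (fun x => u ++ [x] <:+: w)) (fun a b h => by simpa using h)]
    congr 1
    ext t
    rw [Finset.mem_filter, mem_Fac, Finset.mem_image]
    rw [mem_Fac] at hu
    constructor
    · rintro ⟨⟨h1, h2⟩, h3⟩
      have hne : t ≠ [] := by rintro rfl; simp at h2
      have := List.dropLast_append_getLast hne
      rw [h3] at this
      refine ⟨t.getLast hne, ?_, this⟩
      rw [mem_rext, this]; exact h1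
    · rintro ⟨x, hx, rfl⟩
      rw [mem_rext] at hx
      simp [hx, hu.2]
  · intro t ht
    have ht' := (mem_Fac _ _ _).1 ht
    refine (mem_Fac _ _ _).2 ⟨(List.dropLast_prefix t).isInfix.trans ht'.1, ?_⟩
    simp [ht'.2]

/-- Total excess right valence over factors of length `n`. -/
def S (w : List A) (n : ℕ) : ℕ := ∑ u ∈ Fac w n, (rightValence w u - 1)

/-- Suffix of length `n`. -/
def suf (w : List A) (n : ℕ) : List A := w.drop (w.length - n)

theorem suf_suffix (w : List A) (n : ℕ) : suf w n <:+ w := List.drop_suffix _ _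

theorem suf_length (w : List A) (n : ℕ) (h : n ≤ w.length) : (suf w n).length = n := by
  unfold suf; simp; omega

theorem eq_suf {w u : List A} (h : u <:+ w) : u = suf w u.length := by
  obtain ⟨s, rfl⟩ := h
  simp [suf]

theorem suffix_of_not_ext {w u : List A} (h : u <:+: w) (hx : ∀ x, ¬ u ++ [x] <:+: w) :
    u <:+ w := by
  obtain ⟨s, t, rfl⟩ := h
  cases t with
  | nil => exact ⟨s, by simp⟩
  | cons c t => exact absurd ⟨s, t, by simp⟩ (hx c)

/-- if a suffix of `u` is not right extendable then neither is `u`. -/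
theorem not_ext_of_suffix {w u t : List A} (h : t <:+ u) (hx : ∀ x, ¬ t ++ [x] <:+: w) (x : A) :
    ¬ u ++ [x] <:+: w := by
  intro hu
  refine hx x (List.IsInfix.trans ?_ hu)
  obtain ⟨s, rfl⟩ := h
  exact ⟨s, [], by simp⟩

theorem occ_one {w u : List A} (h : u <:+ w) :
    occCount w u = 1 ↔ ∀ x, ¬ u ++ [x] <:+: w := by
  obtain ⟨s, rfl⟩ := h
  unfold occCount
  constructor
  · intro h1 x hx
    obtain ⟨p, q, hpq⟩ := hx
    have := Finset.card_le_one.1 h1.le s.length ?_ p.length ?_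
    · have h2 := congrArg List.length hpq
      simp at h2
      omega
    · simp
    · have h2 := congrArg List.length hpq
      rw [← hpq]
      simp
  · intro hx
    rw [Finset.card_eq_one]
    refine ⟨s.length, ?_⟩
    ext i
    simp only [Finset.mem_filter, Finset.mem_range, Finset.mem_singleton]
    constructor
    · rintro ⟨-, h2, h3⟩
      by_contra hne
      simp only [List.length_append] at h2
      have hlt : i + u.length < (s ++ u).length := by simp; omega
      refine hx (s ++ u)[i + u.length] ?_
      have h4 : u ++ [(s ++ u)[i + u.length]] = ((s ++ u).drop i).take (u.length + 1) := by
        rw [List.take_add_one, h3]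
        simp only [List.getElem?_drop]
        rw [List.getElem?_eq_getElem hlt]; rfl
      rw [h4]
      exact (List.take_prefix _ _).isInfix.trans (List.drop_suffix _ _).isInfix
    · rintro rfl
      simp

theorem K_le_iff (w : List A) (n : ℕ) (hn : n ≤ w.length) :
    K w ≤ n ↔ ∀ x, ¬ suf w n ++ [x] <:+: w := by
  have key : ∀ k, (∃ u : List A, u <:+ w ∧ u.length = k ∧ occCount w u = 1) ↔
      k ≤ w.length ∧ ∀ x, ¬ suf w k ++ [x] <:+: w := by
    intro k
    constructor
    · rintro ⟨u, h1, rfl, h2⟩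
      refine ⟨h1.length_le, ?_⟩
      rw [← eq_suf h1]
      exact (occ_one h1).1 h2
    · rintro ⟨h1, h2⟩
      exact ⟨suf w k, suf_suffix _ _, suf_length _ _ h1, (occ_one (suf_suffix _ _)).2 h2⟩
  unfold K
  constructor
  · intro h
    have hne : {k : ℕ | ∃ u : List A, u <:+ w ∧ u.length = k ∧ occCount w u = 1}.Nonempty := by
      refine ⟨w.length, (key _).2 ⟨le_rfl, fun x hx => ?_⟩⟩
      have := hx.length_le
      rw [List.length_append, suf_length _ _ le_rfl] at this
      simp at this
    have hmem := (key _).1 (Nat.sInf_mem hne)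
    intro x
    refine not_ext_of_suffix ?_ hmem.2 x
    unfold suf
    exact List.drop_suffix_drop_left _ (by omega)
  · intro h
    exact Nat.sInf_le ((key _).2 ⟨hn, h⟩)

theorem K_le (w : List A) : K w ≤ w.length := by
  rw [K_le_iff _ _ le_rfl]
  intro x hx
  have := hx.length_le
  rw [List.length_append, suf_length _ _ le_rfl] at this
  simp at this

theorem K_pos (w : List A) (hw : w ≠ []) : 1 ≤ K w := by
  by_contra h
  have h0 : K w ≤ 0 := by omega
  rw [K_le_iff _ _ (by omega)] at h0
  obtain ⟨a, l, rfl⟩ := List.exists_cons_of_ne_nil hw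
  exact h0 a ⟨[], l, by simp [suf]⟩

theorem C_rec (w : List A) (n : ℕ) (hn : n ≤ w.length) :
    C w (n + 1) + (if K w ≤ n then 1 else 0) = C w n + S w n := by
  have h1 : (if K w ≤ n then 1 else 0) = ∑ u ∈ Fac w n, (if rightValence w u = 0 then 1 else 0) := by
    rw [Finset.sum_eq_single (suf w n)]
    · exact if_congr (by rw [rv_eq_zero, K_le_iff _ _ hn]) rfl rfl
    · intro u hu hne
      rw [mem_Fac] at hu
      rw [if_neg]
      intro h0
      rw [rv_eq_zero] at h0
      have := eq_suf (suffix_of_not_ext hu.1 h0)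
      rw [hu.2] at this
      exact hne this
    · intro h
      exact absurd ((mem_Fac _ _ _).2 ⟨(suf_suffix _ _).isInfix, suf_length _ _ hn⟩) h
  rw [h1, C_succ, S, C_eq, Finset.card_eq_sum_ones, ← Finset.sum_add_distrib,
    ← Finset.sum_add_distrib]
  refine Finset.sum_congr rfl fun u _ => ?_
  split_ifs <;> omega

theorem S_eq_zero (w : List A) (n : ℕ) :
    S w n = 0 ↔ ∀ u : List A, u.length = n → ¬ RightSpecial w u := by
  unfold S RightSpecial
  rw [Finset.sum_eq_zero_iff]
  constructor
  · intro h u hu h2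
    have := h u ((mem_Fac _ _ _).2 ⟨h2.1, hu⟩)
    omega
  · intro h u hu
    have h1 := (mem_Fac _ _ _).1 hu
    have := h u h1.2
    by_contra h3
    exact this ⟨h1.1, by omega⟩

theorem S_zero_succ (w : List A) (n : ℕ) (h : S w n = 0) : S w (n + 1) = 0 := by
  rw [S_eq_zero] at *
  rintro u hu ⟨-, h2⟩
  obtain ⟨x, y, hxy, hx, hy⟩ := (two_le_rv _ _).1 h2
  cases u with
  | nil => simp at hu
  | cons c u =>
    have e : ∀ z, c :: u ++ [z] <:+: w → u ++ [z] <:+: w := fun z hz =>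
      List.IsInfix.trans ⟨[c], [], by simp⟩ hz
    refine h u (by simpa using hu) ⟨List.IsInfix.trans ⟨[], [x], by simp⟩ (e x hx), ?_⟩
    exact (two_le_rv _ _).2 ⟨x, y, hxy, e x hx, e y hy⟩

theorem S_zero_mono (w : List A) {n m : ℕ} (hnm : n ≤ m) (h : S w n = 0) : S w m = 0 := by
  induction hnm with
  | refl => exact h
  | step _ ih => exact S_zero_succ _ _ ih

theorem S_length (w : List A) (n : ℕ) (hn : w.length ≤ n) : S w n = 0 := by
  rw [S_eq_zero]
  rintro u hu ⟨-, h2⟩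
  obtain ⟨x, y, hxy, hx, hy⟩ := (two_le_rv _ _).1 h2
  have := hx.length_le
  simp at this
  omega

theorem R_le_iff (w : List A) (hw : w ≠ []) (n : ℕ) (hn : 1 ≤ n) : R w ≤ n ↔ S w n = 0 := by
  unfold R
  simp only [← S_eq_zero]
  constructor
  · intro h
    have hne : {r : ℕ | 0 < r ∧ S w r = 0}.Nonempty :=
      ⟨w.length, List.length_pos_iff.2 hw, S_length _ _ le_rfl⟩
    exact S_zero_mono w h (Nat.sInf_mem hne).2
  · intro h
    exact Nat.sInf_le ⟨hn, h⟩

theorem R_pos (w : List A) (hw : w ≠ []) : 1 ≤ R w := by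
  unfold R
  simp only [← S_eq_zero]
  have hne : {r : ℕ | 0 < r ∧ S w r = 0}.Nonempty :=
    ⟨w.length, List.length_pos_iff.2 hw, S_length _ _ le_rfl⟩
  exact (Nat.sInf_mem hne).1

theorem C_one (w : List A) : C w 1 = (Alph w).card := by
  rw [C_eq, ← Finset.card_image_of_injective (f := fun x : A => [x]) (Alph w)
    (fun a b h => by simpa using h)]
  congr 1
  ext u
  rw [mem_Fac, Finset.mem_image]
  constructor
  · rintro ⟨h1, h2⟩
    obtain ⟨a, rfl⟩ := List.length_eq_one_iff.1 h2
    exact ⟨a, by simp only [Alph, List.mem_toFinset]; exact h1.subset (by simp), rfl⟩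
  · rintro ⟨a, ha, rfl⟩
    simp only [Alph, List.mem_toFinset] at ha
    obtain ⟨s, t, rfl⟩ := List.append_of_mem ha
    exact ⟨⟨s, t, by simp⟩, rfl⟩

theorem C_gt (w : List A) (n : ℕ) (hn : w.length < n) : C w n = 0 := by
  rw [C_eq, Finset.card_eq_zero, Finset.eq_empty_iff_forall_notMem]
  intro u hu
  rw [mem_Fac] at hu
  have := hu.1.length_le
  omega

theorem C_length (w : List A) : C w w.length = 1 := by
  rw [C_eq, Finset.card_eq_one]
  refine ⟨w, ?_⟩
  ext u
  rw [mem_Fac, Finset.mem_singleton]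
  constructor
  · rintro ⟨h1, h2⟩
    exact h1.eq_of_length h2
  · rintro rfl
    exact ⟨List.infix_rfl, rfl⟩

theorem partial_sum (w : List A) (hw : w ≠ []) (n : ℕ) (hn : n ≤ w.length) :
    C w (n + 1) + (n + 1 - K w) = (Alph w).card + ∑ i ∈ Finset.Icc 1 n, S w i := by
  have hk := K_pos w hw
  induction n with
  | zero => simp [C_one, hk]
  | succ n ih =>
    have h1 := ih (by omega)
    have h2 := C_rec w (n + 1) hn
    rw [Finset.sum_Icc_succ_top (by omega)]
    split_ifs at h2 <;> omega

theorem equality_iff (w : List A) (hw : w ≠ []) :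
    w.length + 2 = R w + K w + (Alph w).card ↔ ∀ n, 1 ≤ n → S w n ≤ 1 := by
  have hl : 1 ≤ w.length := List.length_pos_iff.2 hw
  have h1 := partial_sum w hw w.length le_rfl
  rw [C_gt _ _ (by omega)] at h1
  have hk := K_le w
  have hR := (R_le_iff w hw w.length hl).2 (S_length _ _ le_rfl)
  have hR1 := R_pos w hw
  have h2 : ∑ i ∈ Finset.Icc 1 w.length, (if i < R w then 1 else 0) = R w - 1 := by
    rw [← Finset.sum_filter, ← Finset.card_eq_sum_ones]
    have : (Finset.Icc 1 w.length).filter (fun i => i < R w) = Finset.Ico 1 (R w) := by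
      ext i; simp; omega
    rw [this]; simp
  have h3 : ∀ i ∈ Finset.Icc 1 w.length, (if i < R w then 1 else 0) ≤ S w i := by
    intro i hi
    rw [Finset.mem_Icc] at hi
    have := R_le_iff w hw i hi.1
    split_ifs with h
    · by_contra h4
      have : R w ≤ i := this.2 (by omega)
      omega
    · omega
  have h4 := Finset.sum_eq_sum_iff_of_le h3
  rw [h2] at h4
  have h5 : w.length + 2 = R w + K w + (Alph w).card ↔
      R w - 1 = ∑ i ∈ Finset.Icc 1 w.length, S w i := by omega
  rw [h5, h4]
  constructor
  · intro h n hn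
    by_cases hnl : n ≤ w.length
    · rw [← h n (by simp; omega)]
      split_ifs <;> omega
    · rw [S_length _ _ (by omega)]; omega
  · intro h n hn
    have h6 := h3 n hn
    rw [Finset.mem_Icc] at hn
    have h7 := h n hn.1
    have h8 := R_le_iff w hw n hn.1
    split_ifs at h6 ⊢ with h9
    · omega
    · rw [h8.1 (by omega)]

/-- GT pattern in terms of first differences. -/
def Pat (w : List A) : Prop :=
  ∃ m M : ℕ, 0 < m ∧ m ≤ M ∧ M ≤ w.length ∧
    (∀ i, 1 ≤ i → i < m → C w (i + 1) = C w i + 1) ∧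
    (∀ i, m ≤ i → i < M → C w (i + 1) = C w i) ∧
    (∀ i, M ≤ i → i ≤ w.length → C w (i + 1) + 1 = C w i)

theorem pat_of_S (w : List A) (hw : w ≠ []) (h : ∀ n, 1 ≤ n → S w n ≤ 1) : Pat w := by
  have hl : 1 ≤ w.length := List.length_pos_iff.2 hw
  have hk := K_le w
  have hR := (R_le_iff w hw w.length hl).2 (S_length _ _ le_rfl)
  have hR1 := R_pos w hw
  have hk1 := K_pos w hw
  refine ⟨min (R w) (K w), max (R w) (K w), by omega, by omega, by omega, ?_, ?_, ?_⟩
  all_goals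
    intro i h1 h2
    have h3 := C_rec w i (by omega)
    have h4 := R_le_iff w hw i (by omega)
    have h5 := h i (by omega)
    split_ifs at h3 <;> omega

theorem C_pos (w : List A) (n : ℕ) (hn : n ≤ w.length) : 1 ≤ C w n := by
  rw [C_eq]
  exact Finset.card_pos.2 ⟨suf w n, (mem_Fac _ _ _).2 ⟨(suf_suffix _ _).isInfix, suf_length _ _ hn⟩⟩

theorem isGT_iff (w : List A) (hw : w ≠ []) : IsGT w ↔ Pat w := by
  have hl : 1 ≤ w.length := List.length_pos_iff.2 hw
  have hC0 := C_gt w (w.length + 1) (by omega)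
  have hC1 := C_length w
  constructor
  · rintro ⟨-, h | ⟨m, M, hm, hM, h1, h2, h3⟩⟩
    · refine pat_of_S w hw fun n hn => ?_
      suffices S w n = 0 by omega
      rw [S_eq_zero]
      rintro u - ⟨-, h2⟩
      have : rightValence w u ≤ (Alph w).card := Finset.card_filter_le _ _
      omega
    · have hcard : 1 ≤ (Alph w).card := by
        rw [← C_one]; exact C_pos _ _ hl
      have hmw : m ≤ w.length := by
        by_contra hcon
        have := h1 (w.length + 1) (by omega) (by omega)
        omega
      have hMw : M ≤ w.length := by
        by_contra hcon
        have := h2 w.length hmw (by omega)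
        omega
      refine ⟨m, M, hm, hM, hMw, ?_, ?_, ?_⟩
      · intro i hi him
        have a1 := h1 i hi him.le
        have a2 := h1 (i + 1) (by omega) him
        omega
      · intro i hi him
        exact h2 i hi (by omega)
      · intro i hi him
        have := h3 i hi him
        have := C_pos w i him
        omega
  · rintro ⟨m, M, hm, hM, hMw, h1, h2, h3⟩
    refine ⟨hw, Or.inr ⟨m, M, hm, hM, ?_, ?_, ?_⟩⟩
    · intro i hi
      induction i, hi using Nat.le_induction with
      | base => intro _; rw [C_one]; omega
      | succ i hi ih =>
        intro him
        have := ih (by omega)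
        have := h1 i hi (by omega)
        omega
    · intro i hi him
      exact h2 i hi (by omega)
    · intro i hi him
      have := h3 i hi him
      omega

/-! ### Key combinatorial lemma -/

theorem key_final (z q : List A) (k : ℕ) (a b x y : A) (hq : q.length = k)
    (huniq : ∀ t d e, t.length = k → t ++ [d] <:+: z → t ++ [e] <:+: z → d ≠ e → t = q)
    (hab : ∀ d, q ++ [d] <:+: z → d = a ∨ d = b)
    (hxy : ∀ c, c :: q <:+: z → c = x ∨ c = y)
    (hxa : x :: q ++ [a] <:+: z) (hya : y :: q ++ [a] <:+: z)
    (hxb : x :: q ++ [b] <:+: z) (hyb : y :: q ++ [b] <:+: z)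
    (hne : x ≠ y) (hlen : k + 1 ≤ z.length)
    (hK : ∀ c, ¬ suf z (k + 1) ++ [c] <:+: z) : False := by
  -- any suffix of length at least `k+1` is not extendable
  have hK' : ∀ s, s <:+ z → k + 1 ≤ s.length → ∀ c, ¬ s ++ [c] <:+: z := by
    intro s hs hl c
    refine not_ext_of_suffix ?_ hK c
    exact List.suffix_of_suffix_length_le (suf_suffix _ _) hs (by rw [suf_length _ _ hlen]; exact hl)
  -- last occurrence of `q`
  have hex : ∃ n h, h.length = n ∧ q ++ h <:+ z := by
    obtain ⟨s, t, hst⟩ := hxa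
    exact ⟨_, a :: t, rfl, s ++ [x], by simpa using hst⟩
  classical
  obtain ⟨h, hhl, hh⟩ := Nat.find_spec hex
  have hmin : ∀ h', q ++ h' <:+ z → h.length ≤ h'.length := by
    intro h' hh'
    rw [hhl]
    exact Nat.find_min' hex ⟨h', rfl, hh'⟩
  clear hhl
  cases h with
  | nil =>
    rw [List.append_nil] at hh
    obtain ⟨s, hs⟩ := hh
    rcases List.eq_nil_or_concat s with rfl | ⟨s', c, rfl⟩
    · rw [← hs] at hlen
      simp at hlen; omega
    · have hsuf : c :: q <:+ z := ⟨s', by simpa using hs⟩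
      have hn := hK' _ hsuf (by simp [hq])
      rcases hxy c hsuf.isInfix with rfl | rfl
      · exact hn a hxa
      · exact hn a hya
  | cons c h =>
    have hc : ∀ p : A, p :: q ++ [c] <:+: z → ∀ h1 h2, h = h1 ++ h2 →
        p :: q ++ c :: h1 <:+: z := by
      intro p hp h1
      induction h1 using List.reverseRecOn with
      | nil => intro h2 _; exact hp
      | append_singleton h1 d ih =>
        intro h2 hh2
        have ih' := ih (d :: h2) (by simpa using hh2)
        subst hh2
        have hqd : q ++ c :: h1 ++ [d] <:+: z :=
          List.IsInfix.trans ⟨[], h2, by simp⟩ hh.isInfix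
        -- extendable
        have hext : ∃ e, p :: q ++ c :: h1 ++ [e] <:+: z := by
          by_contra hcon
          push Not at hcon
          have hs := suffix_of_not_ext ih' hcon
          have hs' : q ++ c :: h1 <:+ z := List.IsSuffix.trans ⟨[p], by simp⟩ hs
          exact hK' _ hs' (by simp [hq]) d hqd
        obtain ⟨e, he⟩ := hext
        have : d = e := by
          by_contra hde
          have hl1 : k ≤ (q ++ c :: h1).length := by simp [hq]
          have hts := suf_suffix (q ++ c :: h1) k
          have htl := suf_length (q ++ c :: h1) k hl1
          generalize suf (q ++ c :: h1) k = t at hts htl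
          obtain ⟨r, hr⟩ := hts
          have e1 : t ++ [d] <:+: z := by
            rw [← hr] at hqd
            exact List.IsInfix.trans ⟨r, [], by simp⟩ hqd
          have e2 : t ++ [e] <:+: z := by
            have : p :: q ++ c :: h1 = p :: r ++ t := by simp [← hr]
            rw [this] at he
            exact List.IsInfix.trans ⟨p :: r, [], by simp⟩ he
          have htq := huniq t d e htl e1 e2 hde
          subst htq
          have hlast : t ++ d :: h2 <:+ z := by
            refine List.IsSuffix.trans ⟨r, ?_⟩ hh
            have := congrArg (· ++ (d :: h2)) hr
            simpa using this
          have := hmin _ hlast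
          simp at this
          omega
        subst this
        simpa using he
    have hfin : ∀ p : A, p :: q ++ [c] <:+: z → p :: q ++ c :: h <:+ z := by
      intro p hp
      have h1 := hc p hp h [] (by simp)
      refine suffix_of_not_ext h1 ?_
      refine not_ext_of_suffix ⟨[p], by simp⟩ (hK' _ hh (by simp [hq]))
    have hboth : x :: q ++ [c] <:+: z ∧ y :: q ++ [c] <:+: z := by
      rcases hab c (List.IsInfix.trans ⟨[], h, by simp⟩ hh.isInfix) with rfl | rfl
      · exact ⟨hxa, hya⟩
      · exact ⟨hxb, hyb⟩
    have e1 := eq_suf (hfin x hboth.1)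
    have e2 := eq_suf (hfin y hboth.2)
    have : x :: q ++ c :: h = y :: q ++ c :: h := by
      rw [e1, e2]; simp
    simp at this
    exact hne this

theorem infix_rev {u w : List A} : u.reverse <:+: w.reverse ↔ u <:+: w := List.reverse_infix

theorem C_reverse (w : List A) (n : ℕ) : C w.reverse n = C w n := by
  rw [C_eq, C_eq, ← Finset.card_image_of_injective (Fac w n) List.reverse_injective]
  congr 1
  ext u
  rw [mem_Fac, Finset.mem_image]
  constructor
  · rintro ⟨h1, h2⟩
    refine ⟨u.reverse, (mem_Fac _ _ _).2 ⟨?_, by simpa using h2⟩, by simp⟩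
    rw [← infix_rev]; simpa using h1
  · rintro ⟨t, ht, rfl⟩
    rw [mem_Fac] at ht
    exact ⟨infix_rev.2 ht.1, by simpa using ht.2⟩

theorem S_one (w : List A) (k : ℕ) (h : S w k = 1) :
    ∃ u, u.length = k ∧ rightValence w u = 2 ∧
      ∀ t, t.length = k → 2 ≤ rightValence w t → t = u := by
  have hf : ∀ t, t.length = k → 2 ≤ rightValence w t → t ∈ Fac w k := by
    intro t h1 h2
    obtain ⟨x, y, -, hx, -⟩ := (two_le_rv _ _).1 h2
    exact (mem_Fac _ _ _).2 ⟨List.IsInfix.trans ⟨[], [x], by simp⟩ hx, h1⟩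
  have : ∃ u, u.length = k ∧ 2 ≤ rightValence w u := by
    by_contra hcon
    push Not at hcon
    have : S w k = 0 := by
      rw [S_eq_zero]
      rintro u hu ⟨-, h2⟩
      have := hcon u hu
      omega
    omega
  obtain ⟨u, hu, hu2⟩ := this
  unfold S at h
  have h1 := Finset.single_le_sum (f := fun u => rightValence w u - 1) (fun _ _ => Nat.zero_le _)
    (hf u hu hu2)
  simp only [h] at h1
  refine ⟨u, hu, by omega, ?_⟩
  intro t ht ht2
  by_contra hne
  have h3 : ∑ v ∈ {t, u}, (rightValence w v - 1) ≤ ∑ v ∈ Fac w k, (rightValence w v - 1) := by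
    refine Finset.sum_le_sum_of_subset ?_
    intro v hv
    simp only [Finset.mem_insert, Finset.mem_singleton] at hv
    rcases hv with rfl | rfl
    · exact hf _ ht ht2
    · exact hf _ hu hu2
  rw [Finset.sum_pair hne] at h3
  omega

theorem rv_two (w u : List A) (h : rightValence w u = 2) :
    ∃ x y, x ≠ y ∧ u ++ [x] <:+: w ∧ u ++ [y] <:+: w ∧
      ∀ z, u ++ [z] <:+: w → z = x ∨ z = y := by
  unfold rightValence at h
  obtain ⟨x, y, hxy, he⟩ := Finset.card_eq_two.1 h
  have hm : ∀ z, u ++ [z] <:+: w ↔ z = x ∨ z = y := by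
    intro z
    rw [← mem_rext, he]; simp
  exact ⟨x, y, hxy, (hm x).2 (by simp), (hm y).2 (by simp), fun z => (hm z).1⟩

theorem rv_cons_le (w u : List A) (a : A) : rightValence w (a :: u) ≤ rightValence w u := by
  unfold rightValence
  refine Finset.card_le_card ?_
  intro x hx
  rw [mem_rext] at *
  exact List.IsInfix.trans ⟨[a], [], by simp⟩ hx

theorem core (w : List A) (hw : w ≠ []) (m : ℕ) (hK2 : 2 ≤ K w) (hKH : K w ≤ K w.reverse)
    (hm : K w < m) (hD : ∀ i, 1 ≤ i → i < m → C w (i + 1) = C w i + 1) : False := by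
  obtain ⟨k, hk⟩ : ∃ k, K w = k + 1 := ⟨K w - 1, by omega⟩
  have hKl := K_le w
  have hDk := hD k (by omega) (by omega)
  have hDk1 := hD (k + 1) (by omega) (by omega)
  have r1 := C_rec w k (by omega)
  have r2 := C_rec w (k + 1) (by omega)
  have r3 := C_rec w.reverse k (by simp; omega)
  have r4 := C_rec w.reverse (k + 1) (by simp; omega)
  simp only [C_reverse] at r3 r4
  rw [if_neg (by omega)] at r1 r3
  rw [if_pos (by omega)] at r2
  have s1 : S w k = 1 := by omega
  have s2 : S w (k + 1) = 2 := by omega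
  have s3 : S w.reverse k = 1 := by omega
  obtain ⟨u, hu, hu2, huu⟩ := S_one w k s1
  -- two right special extensions
  have hcons : ∀ t, t.length = k + 1 → 2 ≤ rightValence w t → ∃ a, t = a :: u := by
    intro t ht ht2
    cases t with
    | nil => simp at ht
    | cons a t =>
      have := huu t (by simpa using ht) (ht2.trans (rv_cons_le _ _ _))
      exact ⟨a, by rw [this]⟩
  have hcard : 1 < ((Fac w (k + 1)).filter (fun t => 2 ≤ rightValence w t)).card := by
    have : S w (k + 1) ≤ ((Fac w (k + 1)).filter (fun t => 2 ≤ rightValence w t)).card := by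
      rw [Finset.card_filter, S]
      refine Finset.sum_le_sum fun t ht => ?_
      split_ifs with h
      · obtain ⟨a, rfl⟩ := hcons t ((mem_Fac _ _ _).1 ht).2 h
        have := rv_cons_le w u a
        omega
      · omega
    omega
  obtain ⟨t1, ht1, t2, ht2, hne⟩ := Finset.one_lt_card.1 hcard
  rw [Finset.mem_filter, mem_Fac] at ht1 ht2
  obtain ⟨a, rfl⟩ := hcons t1 ht1.1.2 ht1.2
  obtain ⟨b, rfl⟩ := hcons t2 ht2.1.2 ht2.2
  have hab : a ≠ b := by rintro rfl; exact hne rfl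
  obtain ⟨x, y, hxy, hx, hy, hext⟩ := rv_two w u hu2
  have hfull : ∀ c, 2 ≤ rightValence w (c :: u) → c :: u ++ [x] <:+: w ∧ c :: u ++ [y] <:+: w := by
    intro c hc
    obtain ⟨p, q, hpq, hp, hq⟩ := (two_le_rv _ _).1 hc
    have ep := hext p (List.IsInfix.trans ⟨[c], [], by simp⟩ hp)
    have eq := hext q (List.IsInfix.trans ⟨[c], [], by simp⟩ hq)
    rcases ep with rfl | rfl <;> rcases eq with rfl | rfl
    · exact absurd rfl hpq
    · exact ⟨hp, hq⟩
    · exact ⟨hq, hp⟩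
    · exact absurd rfl hpq
  obtain ⟨hax, hay⟩ := hfull a ht1.2
  obtain ⟨hbx, hby⟩ := hfull b ht2.2
  -- reversed
  have rv : ∀ c d, c :: u ++ [d] <:+: w → d :: u.reverse ++ [c] <:+: w.reverse := by
    intro c d h
    have := infix_rev.2 h
    simpa using this
  have rax := rv _ _ hax
  have ray := rv _ _ hay
  have rbx := rv _ _ hbx
  have rby := rv _ _ hby
  have tl : ∀ c d : A, c :: u.reverse ++ [d] <:+: w.reverse → u.reverse ++ [d] <:+: w.reverse :=
    fun c d h => List.IsInfix.trans ⟨[c], [], by simp⟩ h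
  obtain ⟨q, hq, hq2, hqq⟩ := S_one w.reverse k s3
  have hqu : u.reverse = q := hqq _ (by simpa using hu)
    ((two_le_rv _ _).2 ⟨a, b, hab, tl _ _ rax, tl _ _ rbx⟩)
  subst hqu
  have hH : K w.reverse ≤ k + 1 := by
    by_contra hcon
    rw [if_neg hcon] at r4
    have s4 : S w.reverse (k + 1) = 1 := by omega
    obtain ⟨p, -, -, hp⟩ := S_one _ _ s4
    have e1 := hp (x :: u.reverse) (by simpa using hu) ((two_le_rv _ _).2 ⟨a, b, hab, rax, rbx⟩)
    have e2 := hp (y :: u.reverse) (by simpa using hu) ((two_le_rv _ _).2 ⟨a, b, hab, ray, rby⟩)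
    rw [← e2] at e1
    simp at e1
    exact hxy e1
  have hlen : k + 1 ≤ w.reverse.length := by simp; omega
  obtain ⟨a', b', hab', ha', hb', hext'⟩ := rv_two w.reverse u.reverse hq2
  refine key_final w.reverse u.reverse k a b x y hq ?_ ?_ ?_ rax ray rbx rby hxy hlen
    ((K_le_iff _ _ hlen).1 hH)
  · intro t d e ht hd he hde
    exact hqq t ht ((two_le_rv _ _).2 ⟨d, e, hde, hd, he⟩)
  · intro d hd
    have h1 := hext' a (tl _ _ rax)
    have h2 := hext' b (tl _ _ rbx)
    have h3 := hext' d hd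
    grind
  · intro c hc
    refine hext c ?_
    rw [← infix_rev]
    simpa using hc

theorem S_of_pat (w : List A) (hw : w ≠ []) (hK : 2 ≤ K w) (hH : 2 ≤ K w.reverse) (hp : Pat w) :
    ∀ n, 1 ≤ n → S w n ≤ 1 := by
  obtain ⟨m, M, hm, hmM, hMw, h1, h2, h3⟩ := hp
  intro n hn
  by_contra hcon
  have hnl : n < w.length := by
    by_contra h
    have := S_length w n (by omega)
    omega
  have hr := C_rec w n hnl.le
  have hnm : n < m := by
    by_contra h
    by_cases hM : n < M
    · have := h2 n (by omega) hM
      split_ifs at hr <;> omega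
    · have := h3 n (by omega) (by omega)
      split_ifs at hr <;> omega
  have hKn : K w ≤ n := by
    have := h1 n hn hnm
    split_ifs at hr <;> omega
  rcases le_total (K w) (K w.reverse) with h | h
  · exact core w hw m hK h (by omega) h1
  · refine core w.reverse (by simpa using hw) m hH (by simpa using h) (by omega) ?_
    simpa only [C_reverse] using h1

theorem C_cons (w : List A) (x : A) (hx : x ∉ w) (n : ℕ) (h1 : 1 ≤ n) (hn : n ≤ w.length + 1) :
    C (x :: w) n = C w n + 1 := by
  obtain ⟨n, rfl⟩ : ∃ k, n = k + 1 := ⟨n - 1, by omega⟩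
  have hnot : x :: w.take n ∉ Fac w (n + 1) := by
    rw [mem_Fac]
    rintro ⟨h, -⟩
    exact hx (h.subset (by simp))
  rw [C_eq, C_eq, ← Finset.card_insert_of_notMem hnot]
  congr 1
  ext u
  rw [Finset.mem_insert, mem_Fac, mem_Fac, List.infix_cons_iff]
  constructor
  · rintro ⟨h | h, h2⟩
    · left
      have := List.prefix_iff_eq_take.1 h
      rw [h2] at this
      simpa using this
    · exact Or.inr ⟨h, h2⟩
  · rintro (rfl | h)
    · refine ⟨Or.inl ?_, by simp; omega⟩
      simpa using List.take_prefix n w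
    · exact ⟨Or.inr h.1, h.2⟩

theorem Pat_cons (w : List A) (hw : w ≠ []) (x : A) (hx : x ∉ w) : Pat (x :: w) ↔ Pat w := by
  have hl : 1 ≤ w.length := List.length_pos_iff.2 hw
  have e0 := C_length w
  have e1 := C_gt w (w.length + 1) (by omega)
  have e2 := C_gt (x :: w) (w.length + 1 + 1) (by simp)
  have hc := C_cons w x hx
  have f1 := hc w.length hl (by omega)
  have f2 := hc (w.length + 1) (by omega) le_rfl
  constructor
  · rintro ⟨m, M, hm, hM, hMw, h1, h2, h3⟩
    simp only [List.length_cons] at hMw h3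
    have hMw' : M ≤ w.length := by
      by_contra hcon
      by_cases hmw : m ≤ w.length
      · have := h2 w.length hmw (by omega)
        omega
      · have := h1 w.length hl (by omega)
        omega
    refine ⟨m, M, hm, hM, hMw', ?_, ?_, ?_⟩
    · intro i a b
      have := h1 i a b
      rw [hc _ (by omega) (by omega), hc _ (by omega) (by omega)] at this
      omega
    · intro i a b
      have := h2 i a b
      rw [hc _ (by omega) (by omega), hc _ (by omega) (by omega)] at this
      omega
    · intro i a b
      have := h3 i a (by omega)
      rw [hc _ (by omega) (by omega), hc _ (by omega) (by omega)] at this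
      omega
  · rintro ⟨m, M, hm, hM, hMw, h1, h2, h3⟩
    refine ⟨m, M, hm, hM, by simp; omega, ?_, ?_, ?_⟩
    · intro i a b
      have := h1 i a b
      rw [hc _ (by omega) (by omega), hc _ (by omega) (by omega)]
      omega
    · intro i a b
      have := h2 i a b
      rw [hc _ (by omega) (by omega), hc _ (by omega) (by omega)]
      omega
    · intro i a b
      simp only [List.length_cons] at b
      by_cases hi : i = w.length + 1
      · subst hi
        omega
      · have := h3 i a (by omega)
        rw [hc _ (by omega) (by omega), hc _ (by omega) (by omega)]
        omega

theorem Pat_reverse (w : List A) : Pat w.reverse ↔ Pat w := by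
  unfold Pat
  simp only [C_reverse, List.length_reverse]

theorem Pat_append_left (r w : List A) (hw : w ≠ []) (hr : r.Nodup) (hd : ∀ x ∈ r, x ∉ w) :
    (Pat (r ++ w) ↔ Pat w) ∧
      (r ++ w).length + (Alph w).card = w.length + (Alph (r ++ w)).card := by
  induction r with
  | nil => simp
  | cons x r ih =>
    have ih' := ih (List.nodup_cons.1 hr).2 (fun y hy => hd y (by simp [hy]))
    have hx : x ∉ r ++ w := by
      rw [List.mem_append]
      rintro (h | h)
      · exact (List.nodup_cons.1 hr).1 h
      · exact hd x (by simp) h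
    refine ⟨?_, ?_⟩
    · rw [List.cons_append, Pat_cons _ (by simp [hw]) x hx]
      exact ih'.1
    · have : (Alph (x :: r ++ w)).card = (Alph (r ++ w)).card + 1 := by
        unfold Alph
        rw [List.cons_append, List.toFinset_cons, Finset.card_insert_of_notMem (by simpa using hx)]
      rw [this]
      have := ih'.2
      simp only [List.length_append, List.length_cons] at *
      omega

theorem Alph_reverse (w : List A) : Alph w.reverse = Alph w := by
  unfold Alph; simp

theorem K_two (v : List A) (z : A) (l : List A) (hv : v = l ++ [z]) (hz : z ∈ l) : 2 ≤ K v := by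
  by_contra h
  have h0 : K v ≤ 1 := by omega
  rw [K_le_iff _ _ (by simp [hv])] at h0
  subst hv
  have : suf (l ++ [z]) 1 = [z] := by simp [suf]
  rw [this] at h0
  obtain ⟨s, t, rfl⟩ := List.append_of_mem hz
  cases t with
  | nil => exact h0 z ⟨s, [], by simp⟩
  | cons c t => exact h0 c ⟨s, t ++ [z], by simp⟩

theorem S_nodup (w : List A) (h : ∀ x ∈ w, w.count x = 1) (n : ℕ) (hn : 1 ≤ n) : S w n = 0 := by
  refine S_zero_mono w hn ?_
  rw [S_eq_zero]
  rintro u hu ⟨-, h2⟩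
  obtain ⟨c, rfl⟩ := List.length_eq_one_iff.1 hu
  obtain ⟨x, y, hxy, hx, hy⟩ := (two_le_rv _ _).1 h2
  have hnd : w.Nodup := by
    rw [List.nodup_iff_count_eq_one]; exact h
  obtain ⟨s, t, hs⟩ := hx
  obtain ⟨s', t', hs'⟩ := hy
  have e : s ++ c :: x :: t = s' ++ c :: y :: t' := by
    have := hs.trans hs'.symm
    simpa using this
  have hnd1 : (s ++ c :: x :: t).Nodup := by rw [← hs] at hnd; simpa using hnd
  have hnd2 : (s' ++ c :: y :: t').Nodup := by rw [← e]; exact hnd1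
  have g1 : (s ++ c :: x :: t).idxOf c = s.length := by
    rw [List.idxOf_append_of_notMem]
    · simp
    · grind [List.nodup_append]
  have g2 : (s' ++ c :: y :: t').idxOf c = s'.length := by
    rw [List.idxOf_append_of_notMem]
    · simp
    · grind [List.nodup_append]
  have hl : s.length = s'.length := by rw [← g1, ← g2, e]
  have := List.append_inj_right e hl
  simp at this
  exact hxy this.1

theorem heart_spec (w : List A) (h : ¬ ∀ x ∈ w, w.count x = 1) :
    ∃ r s, w = r ++ heart w ++ s ∧ (∀ x ∈ r, w.count x = 1) ∧ (∀ x ∈ s, w.count x = 1) ∧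
      (∃ a l, heart w = a :: l ∧ w.count a ≠ 1) ∧ (∃ a l, heart w = l ++ [a] ∧ w.count a ≠ 1) := by
  have hgen : ∀ (p : A → Bool) (w : List A), (∃ x ∈ w, p x = false) →
      ∃ r, w = r ++ w.dropWhile p ∧ (∀ x ∈ r, p x = true) ∧
        ∃ a l, w.dropWhile p = a :: l ∧ p a = false := by
    intro p w hx
    refine ⟨w.takeWhile p, List.takeWhile_append_dropWhile.symm, ?_, ?_⟩
    · intro x hx
      exact List.mem_takeWhile_imp hx
    · induction w with
      | nil => simp at hx
      | cons c w ih =>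
        rw [List.dropWhile_cons]
        split_ifs with hc
        · refine ih ?_
          obtain ⟨x, hx, hp⟩ := hx
          rcases List.mem_cons.1 hx with rfl | hx
          · simp [hc] at hp
          · exact ⟨x, hx, hp⟩
        · exact ⟨c, w, rfl, by simpa using hc⟩
  unfold heart
  rw [if_neg h]
  push Not at h
  obtain ⟨x0, hx0, hc0⟩ := h
  set p : A → Bool := fun x => w.count x == 1 with hp
  have hpf : ∀ x, p x = false ↔ w.count x ≠ 1 := by intro x; simp [hp]
  have hpt : ∀ x, p x = true ↔ w.count x = 1 := by intro x; simp [hp]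
  obtain ⟨r, hr, hr1, a, l, hal, hpa⟩ := hgen p w ⟨x0, hx0, (hpf _).2 hc0⟩
  generalize w.dropWhile p = d at *
  obtain ⟨s, hs, hs1, b, l', hbl, hpb⟩ := hgen p d.reverse ⟨a, by simp [hal], hpa⟩
  generalize d.reverse.dropWhile p = d' at *
  have hd : d = d'.reverse ++ s.reverse := by
    have := congrArg List.reverse hs
    simpa using this
  refine ⟨r, s.reverse, ?_, ?_, ?_, ?_, ?_⟩
  · rw [List.append_assoc, ← hd]; exact hr
  · intro x hx; exact (hpt x).1 (hr1 x hx)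
  · intro x hx; exact (hpt x).1 (hs1 x (by simpa using hx))
  · subst hbl
    rcases hrev : (b :: l').reverse with _ | ⟨c, l2⟩
    · simp at hrev
    · rw [hrev, hal] at hd
      have : a = c := by simpa using (List.cons.inj hd).1
      exact ⟨c, l2, rfl, (hpf _).1 (this ▸ hpa)⟩
  · exact ⟨b, l'.reverse, by rw [hbl]; simp, (hpf _).1 hpb⟩

theorem stmt8 (w : List A) (hw : w ≠ []) (v : List A) (hv : v = heart w) :
    IsGT w ↔ w.length + 2 = R v + K v + (Alph w).card := by
  rw [isGT_iff w hw]
  by_cases h : ∀ x ∈ w, w.count x = 1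
  · have : v = w := by rw [hv]; unfold heart; rw [if_pos h]
    subst this
    rw [equality_iff v hw]
    have hS : ∀ n, 1 ≤ n → S v n ≤ 1 := fun n hn => by rw [S_nodup v h n hn]; omega
    exact ⟨fun _ => hS, fun _ => pat_of_S v hw hS⟩
  · obtain ⟨r, s, hwrs, hr, hs, ⟨a, l, hal, ha⟩, ⟨b, l', hbl, hb⟩⟩ := heart_spec w h
    rw [← hv] at hwrs hal hbl
    have hvne : v ≠ [] := by rw [hal]; simp
    have hcount : ∀ x, w.count x = r.count x + v.count x + s.count x := by
      intro x; rw [hwrs]; simp [add_assoc]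
    have hv2 : ∀ x ∈ v, w.count x ≠ 1 → 2 ≤ v.count x := by
      intro x hx hx1
      have h1 : x ∉ r := fun hh => hx1 (hr x hh)
      have h2 : x ∉ s := fun hh => hx1 (hs x hh)
      have := hcount x
      rw [List.count_eq_zero_of_not_mem h1, List.count_eq_zero_of_not_mem h2] at this
      have := List.count_pos_iff.2 hx
      omega
    have hKv : 2 ≤ K v := by
      have := hv2 b (by rw [hbl]; simp) hb
      refine K_two v b l' hbl ?_
      rw [hbl] at this
      simp at this
      exact this
    have hHv : 2 ≤ K v.reverse := by
      have := hv2 a (by rw [hal]; simp) ha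
      refine K_two v.reverse a l.reverse (by rw [hal]; simp) ?_
      rw [hal] at this
      simp at this
      simpa using this
    have hrc : ∀ x ∈ r, r.count x = 1 ∧ v.count x = 0 ∧ s.count x = 0 := by
      intro x hx
      have h1 := hcount x
      have h2 := hr x hx
      have := List.count_pos_iff.2 hx
      omega
    have hsc : ∀ x ∈ s, s.count x = 1 ∧ v.count x = 0 ∧ r.count x = 0 := by
      intro x hx
      have h1 := hcount x
      have h2 := hs x hx
      have := List.count_pos_iff.2 hx
      omega
    have A1 := Pat_append_left s.reverse v.reverse (by simpa using hvne)
      (by rw [List.nodup_reverse, List.nodup_iff_count_eq_one]; exact fun x hx => (hsc x hx).1)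
      (fun x hx => by
        have := (hsc x (by simpa using hx)).2.1
        rw [List.count_eq_zero] at this
        simpa using this)
    rw [← List.reverse_append, Pat_reverse, Pat_reverse, Alph_reverse, Alph_reverse] at A1
    have A2 := Pat_append_left r (v ++ s) (by simp [hvne])
      (by rw [List.nodup_iff_count_eq_one]; exact fun x hx => (hrc x hx).1)
      (fun x hx => by
        have h1 := (hrc x hx).2.1
        have h2 := (hrc x hx).2.2
        rw [List.count_eq_zero] at h1 h2
        simp [h1, h2])
    rw [← List.append_assoc, ← hwrs] at A2
    have hlen := A2.2
    have hlen2 := A1.2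
    simp only [List.length_reverse] at hlen2
    rw [A2.1, A1.1]
    have hE := equality_iff v hvne
    have : Pat v ↔ ∀ n, 1 ≤ n → S v n ≤ 1 := ⟨S_of_pat v hvne hKv hHv, pat_of_S v hvne⟩
    rw [this, ← hE]
    omega
end

section
/- Let w be a generalized trapezoidal word with |Alph(w)| = 2 (i.e., a binary trapezoidal word), and let p be the longest palindromic prefix of w and q the longest palindromic suffix of w. Then p and q are unseparated in w, i.e., |p| + |q| ≥ |w|. -/
open List

variable {A : Type*} [DecidableEq A]

namespace GTW

theorem mem_factors {B : Type*} [DecidableEq B] (w u : List B) : u ∈ factors w ↔ u <:+: w := by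
  unfold factors
  simp only [Finset.mem_image, Finset.mem_product, Finset.mem_range, Prod.exists]
  constructor
  · rintro ⟨i, j, -, rfl⟩
    exact (List.take_prefix _ _).isInfix.trans (List.drop_suffix _ _).isInfix
  · rintro ⟨l, r, rfl⟩
    refine ⟨l.length, u.length, ⟨by simp, by simp; omega⟩, ?_⟩
    simp [List.append_assoc]

theorem C_map {B : Type*} [DecidableEq B] (g : Bool → B) (hg : Function.Injective g)
    (w : List Bool) (n : ℕ) : C (w.map g) n = C w n := by
  unfold C
  rw [← Finset.card_image_of_injective _ (List.map_injective_iff.2 hg)]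
  congr 1
  ext u
  simp only [Finset.mem_filter, Finset.mem_image, mem_factors]
  constructor
  · rintro ⟨⟨l, r, h⟩, hu⟩
    have h := h.symm
    rw [List.map_eq_append_iff] at h
    obtain ⟨l1, r1, rfl, h1, rfl⟩ := h
    rw [List.map_eq_append_iff] at h1
    obtain ⟨l2, r2, rfl, rfl, rfl⟩ := h1
    exact ⟨r2, ⟨⟨l2, r1, rfl⟩, by simpa using hu⟩, rfl⟩
  · rintro ⟨v, ⟨hv, hl⟩, rfl⟩
    exact ⟨hv.map g, by simpa using hl⟩

theorem C_reverse (w : List Bool) (n : ℕ) : C w.reverse n = C w n := by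
  unfold C
  rw [← Finset.card_image_of_injective (Finset.filter _ (factors w)) List.reverse_injective]
  congr 1
  ext u
  simp only [Finset.mem_filter, Finset.mem_image, mem_factors]
  constructor
  · rintro ⟨h, hu⟩
    exact ⟨u.reverse, ⟨by rw [← List.reverse_infix]; simpa using h, by simpa using hu⟩, by simp⟩
  · rintro ⟨v, ⟨hv, hl⟩, rfl⟩
    exact ⟨List.reverse_infix.2 hv, by simpa using hl⟩

/-- right special -/
def RS (w u : List Bool) : Prop := ∀ x : Bool, u ++ [x] <:+: w
/-- left special -/
def LS (w u : List Bool) : Prop := ∀ x : Bool, x :: u <:+: w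

def F (w : List Bool) (n : ℕ) : Finset (List Bool) :=
  (factors w).filter (fun u => u.length = n)

theorem mem_F {w u : List Bool} {n : ℕ} : u ∈ F w n ↔ u <:+: w ∧ u.length = n := by
  simp [F, mem_factors]

open Classical in
noncomputable def rho (w : List Bool) (n : ℕ) : Finset (List Bool) :=
  (F w n).filter (fun u => RS w u)

open Classical in
noncomputable def dead (w : List Bool) (n : ℕ) : Finset (List Bool) :=
  (F w n).filter (fun u => ∀ x : Bool, ¬ u ++ [x] <:+: w)

theorem count (w : List Bool) (n : ℕ) :
    C w (n+1) + (dead w n).card = C w n + (rho w n).card := by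
  classical
  set S : Bool → Finset (List Bool) := fun x => (F w n).filter (fun u => u ++ [x] <:+: w) with hS
  have h1 : C w (n+1) = (S true).card + (S false).card := by
    have e1 : F w (n+1) = (S true).image (· ++ [true]) ∪ (S false).image (· ++ [false]) := by
      ext u
      simp only [hS, Finset.mem_union, Finset.mem_image, Finset.mem_filter, mem_F]
      constructor
      · rintro ⟨hu, hl⟩
        rcases List.eq_nil_or_concat u with rfl | ⟨v, x, rfl⟩
        · simp at hl
        · have : v <:+: w := (List.prefix_append v [x]).isInfix.trans (by simpa using hu)
          have hl' : v.length = n := by simpa using hl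
          cases x
          · right; exact ⟨v, ⟨⟨this, hl'⟩, by simpa using hu⟩, by simp⟩
          · left; exact ⟨v, ⟨⟨this, hl'⟩, by simpa using hu⟩, by simp⟩
      · rintro (⟨v, ⟨⟨h1, h2⟩, h3⟩, rfl⟩ | ⟨v, ⟨⟨h1, h2⟩, h3⟩, rfl⟩)
        · exact ⟨h3, by simp [h2]⟩
        · exact ⟨h3, by simp [h2]⟩
    have : C w (n+1) = (F w (n+1)).card := rfl
    rw [this, e1, Finset.card_union_of_disjoint, Finset.card_image_of_injective,
      Finset.card_image_of_injective]
    · exact fun a b h => by simpa using h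
    · exact fun a b h => by simpa using h
    · rw [Finset.disjoint_left]
      simp only [Finset.mem_image, not_exists, not_and]
      rintro _ ⟨v, _, rfl⟩ u _ h
      have := congrArg List.getLast? h
      simp at this
  have h2 := Finset.card_union_add_card_inter (S true) (S false)
  have h3 : S true ∩ S false = rho w n := by
    ext u
    simp only [hS, rho, RS, Finset.mem_inter, Finset.mem_filter, Bool.forall_bool]
    tauto
  have h4 : F w n = (S true ∪ S false) ∪ dead w n := by
    ext u
    simp only [hS, dead, Finset.mem_union, Finset.mem_filter, Bool.forall_bool]
    tauto
  have h5 : C w n = (S true ∪ S false).card + (dead w n).card := by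
    have : C w n = (F w n).card := rfl
    rw [this, h4, Finset.card_union_of_disjoint]
    rw [Finset.disjoint_left]
    intro u
    simp only [hS, dead, Finset.mem_union, Finset.mem_filter, Bool.forall_bool]
    tauto
  rw [h3] at h2
  omega

theorem dead_suffix {w u : List Bool} {n : ℕ} (h : u ∈ dead w n) : u <:+ w := by
  simp only [dead, Finset.mem_filter, mem_F] at h
  obtain ⟨⟨⟨l, r, rfl⟩, _⟩, h⟩ := h
  cases r with
  | nil => exact ⟨l, by simp⟩
  | cons x r => exact absurd ⟨l, r, by simp⟩ (h x)

theorem suffix_len_eq {u v w : List Bool} (hu : u <:+ w) (hv : v <:+ w) (h : u.length = v.length) :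
    u = v :=
  (List.suffix_of_suffix_length_le hu hv h.le).eq_of_length h

theorem prefix_len_eq {u v w : List Bool} (hu : u <+: w) (hv : v <+: w) (h : u.length = v.length) :
    u = v :=
  (List.prefix_of_prefix_length_le hu hv h.le).eq_of_length h

theorem dead_card_le (w : List Bool) (n : ℕ) : (dead w n).card ≤ 1 := by
  rw [Finset.card_le_one]
  intro a ha b hb
  have h1 := dead_suffix ha
  have h2 := dead_suffix hb
  simp only [dead, Finset.mem_filter, mem_F] at ha hb
  exact suffix_len_eq h1 h2 (by rw [ha.1.2, hb.1.2])

theorem C_zero (w : List Bool) : C w 0 = 1 := by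
  have : C w 0 = (F w 0).card := rfl
  rw [this, Finset.card_eq_one]
  refine ⟨[], ?_⟩
  ext u
  simp only [mem_F, Finset.mem_singleton, List.length_eq_zero_iff]
  constructor
  · exact fun h => h.2
  · rintro rfl; exact ⟨List.nil_infix, rfl⟩

theorem C_len (w : List Bool) : C w w.length = 1 := by
  have : C w w.length = (F w w.length).card := rfl
  rw [this, Finset.card_eq_one]
  refine ⟨w, ?_⟩
  ext u
  simp only [mem_F, Finset.mem_singleton]
  constructor
  · exact fun h => h.1.eq_of_length h.2
  · rintro rfl; exact ⟨List.infix_rfl, rfl⟩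

theorem C_big (w : List Bool) (n : ℕ) (h : w.length < n) : C w n = 0 := by
  have : C w n = (F w n).card := rfl
  rw [this, Finset.card_eq_zero, Finset.eq_empty_iff_forall_notMem]
  intro u hu
  rw [mem_F] at hu
  have := hu.1.length_le
  omega

theorem RS.drop {w u v : List Bool} (h : RS w u) (hv : v <:+ u) : RS w v := by
  intro x
  refine List.IsInfix.trans ?_ (h x)
  obtain ⟨l, rfl⟩ := hv
  exact ⟨l, [], by simp⟩

theorem LS.take {w u v : List Bool} (h : LS w u) (hv : v <+: u) : LS w v := by
  intro x
  refine List.IsInfix.trans ?_ (h x)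
  obtain ⟨l, rfl⟩ := hv
  exact ⟨[], l, by simp⟩

theorem RS.fac {w u : List Bool} (h : RS w u) : u <:+: w :=
  (List.prefix_append u [true]).isInfix.trans (h true)

theorem RS_reverse {w u : List Bool} : RS w.reverse u ↔ LS w u.reverse := by
  unfold RS LS
  constructor
  · intro h x
    rw [← List.reverse_infix]; simpa using h x
  · intro h x
    rw [← List.reverse_infix]; simpa using h x

structure T (w : List Bool) : Prop where
  rs : ∀ u v : List Bool, u.length = v.length → RS w u → RS w v → u = v
  ls : ∀ u v : List Bool, u.length = v.length → LS w u → LS w v → u = v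

theorem T.fac {w v : List Bool} (h : T w) (hv : v <:+: w) : T v where
  rs a b e ha hb := h.rs a b e (fun x => (ha x).trans hv) (fun x => (hb x).trans hv)
  ls a b e ha hb := h.ls a b e (fun x => (ha x).trans hv) (fun x => (hb x).trans hv)

theorem T.reverse {w : List Bool} (h : T w) : T w.reverse where
  rs a b e ha hb := by
    rw [RS_reverse] at ha hb
    exact List.reverse_injective (h.ls _ _ (by simpa using e) ha hb)
  ls a b e ha hb := by
    rw [← List.reverse_reverse a, ← RS_reverse, List.reverse_reverse] at ha
    rw [← List.reverse_reverse b, ← RS_reverse, List.reverse_reverse] at hb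
    exact List.reverse_injective (h.rs _ _ (by simpa using e) ha hb)

/-- upper bound lemma -/
theorem lemI {w : List Bool} (hT : T w) {n : ℕ} (hn : ∀ u : List Bool, u.length = n → ¬ RS w u)
    {q : List Bool} (hq : q <:+ w) (huni : ∀ l r : List Bool, w = l ++ q ++ r → r = []) :
    w.length ≤ n + q.length := by
  have key : ∀ i, i ≤ w.length → C w i + (i - q.length) ≤ 1 + min i n := by
    intro i
    induction i with
    | zero => intro _; simp [C_zero]
    | succ i ih =>
      intro hi
      have ih := ih (by omega)
      have hc := count w i
      have hr1 : (rho w i).card ≤ 1 := by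
        rw [Finset.card_le_one]
        intro a ha b hb
        simp only [rho, Finset.mem_filter, mem_F] at ha hb
        exact hT.rs _ _ (by rw [ha.1.2, hb.1.2]) ha.2 hb.2
      have hr2 : n ≤ i → (rho w i).card = 0 := by
        intro h
        rw [Finset.card_eq_zero, Finset.eq_empty_iff_forall_notMem]
        intro a ha
        simp only [rho, Finset.mem_filter, mem_F] at ha
        exact hn (a.drop (i - n)) (by rw [List.length_drop]; omega) (ha.2.drop (List.drop_suffix _ _))
      have hd : q.length ≤ i → 1 ≤ (dead w i).card := by
        intro h
        rw [Nat.one_le_iff_ne_zero, ← Nat.pos_iff_ne_zero, Finset.card_pos]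
        refine ⟨w.drop (w.length - i), ?_⟩
        simp only [dead, Finset.mem_filter, mem_F]
        have hl : (w.drop (w.length - i)).length = i := by rw [List.length_drop]; omega
        refine ⟨⟨(List.drop_suffix _ _).isInfix, hl⟩, ?_⟩
        rintro x ⟨l, r, hx⟩
        obtain ⟨t, ht⟩ := List.suffix_of_suffix_length_le hq
          (List.drop_suffix (w.length - i) w) (by omega)
        rw [← ht] at hx
        have := huni (l ++ t) (x :: r) (by rw [← hx]; simp)
        simp at this
      rcases Nat.lt_or_ge i n with h1 | h1 <;> rcases Nat.lt_or_ge i q.length with h2 | h2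
      · omega
      · have := hd h2; omega
      · have := hr2 h1; omega
      · have := hr2 h1; have := hd h2; omega
  have := key w.length le_rfl
  rw [C_len] at this
  have := hq.length_le
  omega

/-- lower bound lemma -/
theorem lemII {w u q : List Bool} (hu : RS w u) (hq : q <:+ w)
    (hrep : ∃ l r : List Bool, w = l ++ q ++ r ∧ r ≠ []) :
    u.length + q.length + 2 ≤ w.length := by
  obtain ⟨l, r, hw, hr⟩ := hrep
  have key : ∀ i, i ≤ w.length → 1 + min i (u.length + 1) ≤ C w i + (i - (q.length + 1)) := by
    intro i
    induction i with
    | zero => intro _; simp [C_zero]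
    | succ i ih =>
      intro hi
      have ih := ih (by omega)
      have hc := count w i
      have hd1 := dead_card_le w i
      have hr2 : i ≤ u.length → 1 ≤ (rho w i).card := by
        intro h
        rw [Nat.one_le_iff_ne_zero, ← Nat.pos_iff_ne_zero, Finset.card_pos]
        refine ⟨u.drop (u.length - i), ?_⟩
        simp only [rho, Finset.mem_filter, mem_F]
        have h1 := hu.drop (List.drop_suffix (u.length - i) u)
        exact ⟨⟨h1.fac, by rw [List.length_drop]; omega⟩, h1⟩
      have hd : i ≤ q.length → (dead w i).card = 0 := by
        intro h
        rw [Finset.card_eq_zero, Finset.eq_empty_iff_forall_notMem]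
        intro a ha
        have hs := dead_suffix ha
        simp only [dead, Finset.mem_filter, mem_F] at ha
        obtain ⟨t, ht⟩ := List.suffix_of_suffix_length_le hs hq (by omega)
        cases r with
        | nil => exact hr rfl
        | cons x r => exact ha.2 x ⟨l ++ t, r, by rw [hw, ← ht]; simp⟩
      rcases Nat.lt_or_ge u.length i with h1 | h1 <;> rcases Nat.lt_or_ge q.length i with h2 | h2
      · omega
      · have := hd h2; omega
      · have := hr2 h1; omega
      · have := hr2 h1; have := hd h2; omega
  have := key w.length le_rfl
  rw [C_len] at this
  have h1 := hq.length_le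
  have h2 := (hu true).length_le
  have h3 : q.length + 1 ≤ w.length := by
    have := List.length_pos_iff.2 hr
    rw [hw]; simp; omega
  simp at h2
  omega

theorem bnot {x y : Bool} (h : x ≠ y) : x = !y := by
  revert x y
  decide

/-- the longest common suffix decomposition -/
theorem common_suf_split (a b : List Bool) : ∃ a' b' c : List Bool, a = a' ++ c ∧ b = b' ++ c ∧
    (a' = [] ∨ b' = [] ∨ ∃ a'' b'' : List Bool, ∃ y : Bool, a' = a'' ++ [y] ∧ b' = b'' ++ [!y]) := by
  induction a using List.reverseRecOn generalizing b with
  | nil => exact ⟨[], b, [], by simp, by simp, Or.inl rfl⟩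
  | append_singleton a x ih =>
    rcases List.eq_nil_or_concat b with rfl | ⟨b, y, rfl⟩
    · exact ⟨a ++ [x], [], [], by simp, by simp, Or.inr (Or.inl rfl)⟩
    · by_cases hxy : x = y
      · subst hxy
        obtain ⟨a', b', c, rfl, rfl, h⟩ := ih b
        exact ⟨a', b', c ++ [x], by simp, by simp, h⟩
      · refine ⟨a ++ [x], b ++ [y], [], by simp, by simp, Or.inr (Or.inr ⟨a, b, x, rfl, ?_⟩)⟩
        have : y = !x := by cases x <;> cases y <;> simp_all
        rw [this]

theorem common_pre_split (a b : List Bool) (hl : a.length = b.length) (hne : a ≠ b) :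
    ∃ g a' b' : List Bool, ∃ y : Bool, a = g ++ y :: a' ∧ b = g ++ (!y) :: b' := by
  induction a generalizing b with
  | nil => cases b <;> simp_all
  | cons x a ih =>
    cases b with
    | nil => simp at hl
    | cons y b =>
      by_cases hxy : x = y
      · subst hxy
        obtain ⟨g, a', b', z, rfl, rfl⟩ := ih b (by simpa using hl) (by simpa using hne)
        exact ⟨x :: g, a', b', z, by simp, by simp⟩
      · have : y = !x := by cases x <;> cases y <;> simp_all
        exact ⟨[], a, b, x, by simp, by simp [this]⟩

set_option maxHeartbeats 2000000 in
theorem rs_unique {w : List Bool} (hC : ∀ i, C w (i+1) ≤ C w i + 1) :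
    ∀ n, ∀ u v : List Bool, u.length = n → v.length = n → RS w u → RS w v → u = v := by
  intro n
  induction n with
  | zero =>
    intro u v hu hv _ _
    rw [List.length_eq_zero_iff] at hu hv
    rw [hu, hv]
  | succ n ih =>
    intro u v hu hv hru hrv
    by_contra hne
    obtain ⟨x, t, rfl⟩ := List.exists_cons_of_length_eq_add_one hu
    obtain ⟨y, t', rfl⟩ := List.exists_cons_of_length_eq_add_one hv
    have ht : t.length = n := by simpa using hu
    have : t = t' := ih t t' ht (by simpa using hv)
      (hru.drop (List.suffix_cons _ _)) (hrv.drop (List.suffix_cons _ _))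
    subst this
    have hall : ∀ z : Bool, RS w (z :: t) := by
      intro z
      have : z = x ∨ z = y := by
        have hxy : x ≠ y := fun h => hne (by rw [h])
        clear * - hxy
        revert x y z
        decide
      rcases this with rfl | rfl <;> assumption
    have hls : ∀ d : Bool, LS w (t ++ [d]) := fun d z => by simpa using hall z d
    -- counting in the reversed word
    have hcnt := count w.reverse (n+1)
    rw [C_reverse, C_reverse] at hcnt
    have hcn := hC (n+1)
    have hd1 := dead_card_le w.reverse (n+1)
    have hmem : ∀ d : Bool, (t ++ [d]).reverse ∈ rho w.reverse (n+1) := by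
      intro d
      have h1 : RS w.reverse (t ++ [d]).reverse := by
        rw [RS_reverse, List.reverse_reverse]; exact hls d
      simp only [rho, Finset.mem_filter, mem_F]
      exact ⟨⟨h1.fac, by simp [ht]⟩, h1⟩
    have hsub : ({(t ++ [true]).reverse, (t ++ [false]).reverse} : Finset (List Bool))
        ⊆ rho w.reverse (n+1) := by
      intro z hz
      simp only [Finset.mem_insert, Finset.mem_singleton] at hz
      rcases hz with rfl | rfl
      · exact hmem true
      · exact hmem false
    have hcard2 : ({(t ++ [true]).reverse, (t ++ [false]).reverse} : Finset (List Bool)).card = 2 := by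
      rw [Finset.card_pair]; simp
    have heq := Finset.eq_of_subset_of_card_le hsub (by rw [hcard2]; omega)
    have hLS : ∀ s : List Bool, s.length = n+1 → LS w s → ∃ d, s = t ++ [d] := by
      intro s hs hss
      have h1 : RS w.reverse s.reverse := by rw [RS_reverse, List.reverse_reverse]; exact hss
      have : s.reverse ∈ rho w.reverse (n+1) := by
        simp only [rho, Finset.mem_filter, mem_F]
        exact ⟨⟨h1.fac, by simp [hs]⟩, h1⟩
      rw [← heq] at this
      simp only [Finset.mem_insert, Finset.mem_singleton, List.reverse_inj] at this
      rcases this with h | h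
      · exact ⟨_, h⟩
      · exact ⟨_, h⟩
    have hge := Finset.card_le_card hsub
    have hdpos : 0 < (dead w.reverse (n+1)).card := by omega
    obtain ⟨π, hπ⟩ := Finset.card_pos.1 hdpos
    have hπs := dead_suffix hπ
    simp only [dead, Finset.mem_filter, mem_F] at hπ
    have hpre : ∀ s : List Bool, s <+: w → s.length = n+1 → ∀ z : Bool, ¬ z :: s <:+: w := by
      intro s hs hsl z hz
      have : π = s.reverse := suffix_len_eq hπs (List.reverse_suffix.2 hs) (by simp [hπ.1.2, hsl])
      apply hπ.2 z
      rw [this, ← List.reverse_infix]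
      simpa using hz
    -- first occurrence
    have hex : ∃ k : ℕ, ∃ l r : List Bool, ∃ z : Bool, l.length = k ∧ w = l ++ z :: t ++ r := by
      obtain ⟨l, r, h⟩ := (hall true).fac
      exact ⟨_, l, r, true, rfl, h.symm⟩
    classical
    obtain ⟨l, r, z, hlk, hw⟩ := Nat.find_spec hex
    have hmin : ∀ l' r' : List Bool, ∀ z' : Bool, w = l' ++ z' :: t ++ r' → l.length ≤ l'.length := by
      intro l' r' z' h
      rw [hlk]
      exact Nat.find_min' hex ⟨l', r', z', rfl, h⟩
    -- another occurrence
    have hother : ∃ l1 r1 : List Bool, w = l1 ++ z :: t ++ r1 ∧ l1 ≠ l := by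
      obtain ⟨la, ra, ha⟩ := hall z true
      obtain ⟨lb, rb, hb⟩ := hall z false
      by_cases h : la = l
      · refine ⟨lb, false :: rb, by rw [← hb]; simp, ?_⟩
        rintro rfl
        subst h
        rw [← ha] at hb
        simp at hb
      · exact ⟨la, true :: ra, by rw [← ha]; simp, h⟩
    obtain ⟨l1, r1, hw1, hne1⟩ := hother
    have hlt : l.length < l1.length := by
      refine lt_of_le_of_ne (hmin _ _ _ hw1) ?_
      intro h
      apply hne1
      exact (prefix_len_eq (w := w) ⟨z :: t ++ r, by rw [hw]; simp⟩
        ⟨z :: t ++ r1, by rw [hw1]; simp⟩ h).symm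
    obtain ⟨a, b, c, rfl, rfl, hcase⟩ := common_suf_split l l1
    simp only [List.length_append] at hlt
    obtain ⟨s, s', hs⟩ : ∃ s s' : List Bool, c ++ z :: t = s ++ s' ∧ s.length = n + 1 :=
      ⟨(c ++ z :: t).take (n+1), (c ++ z :: t).drop (n+1), by simp, by simp; omega⟩
    have e1 : w = a ++ s ++ (s' ++ r) := by
      calc w = a ++ (c ++ z :: t) ++ r := by rw [hw]; simp
        _ = _ := by rw [hs.1]; simp
    have e2 : w = b ++ s ++ (s' ++ r1) := by
      calc w = b ++ (c ++ z :: t) ++ r1 := by rw [hw1]; simp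
        _ = _ := by rw [hs.1]; simp
    rcases hcase with rfl | rfl | ⟨a'', b'', y, rfl, rfl⟩
    · rcases List.eq_nil_or_concat b with rfl | ⟨b, y, rfl⟩
      · simp at hlt
      · exact hpre s ⟨_, e1.symm⟩ hs.2 y ⟨b, s' ++ r1, by rw [e2]; simp⟩
    · simp at hlt
    · have hL : LS w s := by
        have h1 : y :: s <:+: w := ⟨a'', s' ++ r, by rw [e1]; simp⟩
        have h2 : (!y) :: s <:+: w := ⟨b'', s' ++ r1, by rw [e2]; simp⟩
        intro x
        by_cases hx : x = y
        · rw [hx]; exact h1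
        · have : x = !y := bnot hx
          rw [this]; exact h2
      obtain ⟨d, rfl⟩ := hLS s hs.2 hL
      have := hmin a'' ([d] ++ (s' ++ r)) y (by rw [e1]; simp)
      simp at this

theorem T_of_C {w : List Bool} (hC : ∀ i, C w (i+1) ≤ C w i + 1) : T w where
  rs u v h hu hv := rs_unique hC _ u v rfl h.symm hu hv
  ls u v h hu hv := by
    have hC' : ∀ i, C w.reverse (i+1) ≤ C w.reverse i + 1 := by
      intro i; rw [C_reverse, C_reverse]; exact hC i
    apply List.reverse_injective
    refine rs_unique hC' _ u.reverse v.reverse rfl (by simp [h]) ?_ ?_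
    · rw [RS_reverse, List.reverse_reverse]; exact hu
    · rw [RS_reverse, List.reverse_reverse]; exact hv

/-- `p` is the longest palindromic prefix of `w` -/
structure LPP (w p : List Bool) : Prop where
  pre : p <+: w
  pal : p.reverse = p
  max : ∀ p' : List Bool, p' <+: w → p'.reverse = p' → p'.length ≤ p.length

/-- `q` is the longest palindromic suffix of `w` -/
structure LPS (w q : List Bool) : Prop where
  suf : q <:+ w
  pal : q.reverse = q
  max : ∀ q' : List Bool, q' <:+ w → q'.reverse = q' → q'.length ≤ q.length

theorem LPP.rev {w p : List Bool} (h : LPP w p) : LPS w.reverse p where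
  suf := by have := List.reverse_suffix.2 h.pre; rwa [h.pal] at this
  pal := h.pal
  max p' h1 h2 := h.max p' (by rw [← List.reverse_suffix, h2]; exact h1) h2

theorem LPS.rev {w p : List Bool} (h : LPS w p) : LPP w.reverse p where
  pre := by have := List.reverse_prefix.2 h.suf; rwa [h.pal] at this
  pal := h.pal
  max p' h1 h2 := h.max p' (by rw [← List.reverse_prefix, h2]; exact h1) h2

theorem LPP.exists (w : List Bool) : ∃ p, LPP w p := by
  classical
  have hex : ∃ k : ℕ, ∃ p : List Bool, p <+: w ∧ p.reverse = p ∧ w.length = k + p.length :=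
    ⟨w.length, [], List.nil_prefix, rfl, by simp⟩
  obtain ⟨p, h1, h2, h3⟩ := Nat.find_spec hex
  refine ⟨p, h1, h2, fun p' h1' h2' => ?_⟩
  by_contra hlt
  have hle := h1'.length_le
  exact Nat.find_min hex (m := w.length - p'.length) (by omega) ⟨p', h1', h2', by omega⟩

theorem LPS.exists (w : List Bool) : ∃ p, LPS w p := by
  obtain ⟨p, hp⟩ := LPP.exists w.reverse
  exact ⟨p, by simpa using hp.rev⟩

structure Cex (w p q : List Bool) : Prop where
  t : T w
  hp : LPP w p
  hq : LPS w q
  lt : p.length + q.length < w.length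
  ih : ∀ v p' q' : List Bool, v.length < w.length → T v → LPP v p' → LPS v q' →
    v.length ≤ p'.length + q'.length

theorem Cex.rev {w p q : List Bool} (h : Cex w p q) : Cex w.reverse q p where
  t := h.t.reverse
  hp := h.hq.rev
  hq := h.hp.rev
  lt := by have := h.lt; simp; omega
  ih v p' q' hv ht h1 h2 := by
    have := h.ih v.reverse q' p' (by simpa using hv) ht.reverse h2.rev h1.rev
    simp at this; omega

theorem Cex.p_pos {w p q : List Bool} (h : Cex w p q) : 0 < p.length := by
  cases w with
  | nil => have := h.lt; simp at this
  | cons e w => exact h.hp.max [e] ⟨w, rfl⟩ rfl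

theorem Cex.q_pos {w p q : List Bool} (h : Cex w p q) : 0 < q.length := h.rev.p_pos

/-- key step: structure obtained by removing the first letter -/
theorem Cex.step {w p q : List Bool} (h : Cex w p q) :
    ∃ (e : Bool) (Q β p'' : List Bool), w = e :: Q ++ (!e) :: β ∧ Q.reverse = Q ∧
      w.length ≤ Q.length + q.length + 1 ∧ p = e :: p'' ∧ RS w p''.reverse := by
  have hlt := h.lt
  have hpp := h.p_pos
  have hqp := h.q_pos
  cases w with
  | nil => simp at hlt
  | cons e w1 =>
    obtain ⟨Q, hQ⟩ := LPP.exists w1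
    have hq1 : LPS w1 q := by
      refine ⟨?_, h.hq.pal, fun q' h1 h2 => h.hq.max q' (h1.trans (List.suffix_cons _ _)) h2⟩
      rcases List.suffix_cons_iff.1 h.hq.suf with h1 | h1
      · rw [h1] at hlt; simp only [List.length_cons] at hlt; omega
      · exact h1
    have hle := h.ih w1 Q q (by simp) (h.t.fac (List.suffix_cons _ _).isInfix) hQ hq1
    simp only [List.length_cons] at hlt
    obtain ⟨β, hβ⟩ := hQ.pre
    cases β with
    | nil =>
      simp only [List.append_nil] at hβ
      subst hβ
      have := hq1.max Q List.suffix_rfl hQ.pal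
      omega
    | cons f β =>
      have hf : f = !e := by
        apply bnot
        rintro rfl
        have := h.hp.max (f :: Q ++ [f]) ⟨β, by simp [← hβ]⟩ (by simp [hQ.pal])
        simp at this
        omega
      subst hf
      obtain ⟨t, ht⟩ := h.hp.pre
      cases p with
      | nil => simp at hpp
      | cons e' p'' =>
        simp only [List.cons_append, List.cons.injEq] at ht
        obtain ⟨rfl, ht⟩ := ht
        refine ⟨e', Q, β, p'', by simp [← hβ], hQ.pal, by simp; omega, rfl, ?_⟩
        have hpQ : p'' <+: Q := List.prefix_of_prefix_length_le ⟨t, ht⟩ hQ.pre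
          (by simp at hlt; omega)
        have hsQ : p''.reverse <:+ Q := by
          rw [← hQ.pal]; exact List.reverse_suffix.2 hpQ
        obtain ⟨s, hs⟩ := hsQ
        intro x
        by_cases hx : x = e'
        · subst hx
          have := h.hp.pal
          simp only [List.reverse_cons] at this
          rw [this]
          exact h.hp.pre.isInfix
        · rw [bnot hx]
          exact ⟨e' :: s, β, by rw [← hβ, ← hs]; simp⟩

theorem overlap {l p : List Bool} (hp : p.reverse = p) (h1 : p <+: l ++ p)
    (hl : l.length ≤ p.length) : (l ++ p).reverse = l ++ p := by
  obtain ⟨t, ht⟩ := h1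
  have hlen : t.length = l.length := by
    have := congrArg List.length ht
    simp at this; omega
  have h2 : t <:+ p := List.suffix_of_suffix_length_le ⟨p, ht⟩ ⟨l, rfl⟩ (by omega)
  have h3 : l <+: p := List.prefix_of_prefix_length_le ⟨p, rfl⟩ ⟨t, ht⟩ hl
  have h4 : l.reverse <:+ p := by rw [← hp]; exact List.reverse_suffix.2 h3
  have h5 : t = l.reverse := suffix_len_eq h2 h4 (by simp [hlen])
  rw [List.reverse_append, hp, ← h5, ht]

theorem Cex.occ {w p q : List Bool} (h : Cex w p q) :
    (∀ l r : List Bool, w = l ++ p ++ r → l = []) ∨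
    (p = q ∧ ∀ l r : List Bool, w = l ++ p ++ r → l = [] ∨ r = []) := by
  classical
  by_cases hu : ∀ l r : List Bool, w = l ++ p ++ r → l = []
  · exact Or.inl hu
  right
  have hlt := h.lt
  have hex : ∃ k : ℕ, ∃ l r : List Bool, l.length = k ∧ w = l ++ p ++ r ∧ l ≠ [] := by
    push Not at hu
    obtain ⟨l, r, h1, h2⟩ := hu
    exact ⟨_, l, r, rfl, h1, h2⟩
  obtain ⟨l, r, hlk, hw, hl⟩ := Nat.find_spec hex
  have hmin : ∀ l' r' : List Bool, w = l' ++ p ++ r' → l' ≠ [] → l.length ≤ l'.length := by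
    intro l' r' h1 h2
    rw [hlk]
    exact Nat.find_min' hex ⟨l', r', rfl, h1, h2⟩
  have hlpos := List.length_pos_iff.2 hl
  have hvpre : l ++ p <+: w := ⟨r, hw.symm⟩
  have hpv : p <+: l ++ p := List.prefix_of_prefix_length_le h.hp.pre hvpre (by simp)
  have hnp : (l ++ p).reverse ≠ l ++ p := by
    intro hh
    have := h.hp.max _ hvpre hh
    simp only [List.length_append] at this
    omega
  have hsmax : ∀ x : List Bool, x <:+ l ++ p → x.reverse = x → x.length ≤ p.length := by
    intro x hx hxp
    by_contra hlt
    obtain ⟨y, hy⟩ := hx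
    have hps : p <:+ x := List.suffix_of_suffix_length_le ⟨l, rfl⟩ ⟨y, hy⟩ (by omega)
    have hpx : p <+: x := by
      have := List.reverse_prefix.2 hps
      rwa [hxp, h.hp.pal] at this
    obtain ⟨x', rfl⟩ := hpx
    by_cases hy0 : y = []
    · subst hy0
      simp only [List.nil_append] at hy
      rw [hy] at hxp
      exact hnp hxp
    · have := hmin y (x' ++ r) (by rw [hw, ← hy]; simp) hy0
      have h2 := congrArg List.length hy
      simp only [List.length_append] at h2 hlt
      omega
  have hr : r = [] := by
    by_contra hr
    have hrpos := List.length_pos_iff.2 hr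
    have hlen : (l ++ p).length ≤ p.length + p.length := by
      refine h.ih (l ++ p) p p (by rw [hw]; simp; omega) (h.t.fac hvpre.isInfix) ?_ ?_
      · exact ⟨hpv, h.hp.pal, fun p' h1 h2 => h.hp.max p' (h1.trans hvpre) h2⟩
      · exact ⟨⟨l, rfl⟩, h.hp.pal, hsmax⟩
    simp at hlen
    exact hnp (overlap h.hp.pal hpv hlen)
  subst hr
  simp only [List.append_nil] at hw
  have hps : p <:+ w := ⟨l, hw.symm⟩
  have hqp : q.length ≤ p.length := hsmax q (by rw [← hw]; exact h.hq.suf) h.hq.pal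
  refine ⟨suffix_len_eq hps h.hq.suf (le_antisymm (h.hq.max p hps h.hp.pal) hqp), ?_⟩
  intro l' r' hw'
  by_cases hl' : l' = []
  · exact Or.inl hl'
  right
  have h1 := hmin l' r' hw' hl'
  have h2 := congrArg List.length hw
  have h3 := congrArg List.length hw'
  simp at h2 h3
  apply List.length_eq_zero_iff.1
  omega

/-- case A: both unioccurrent -/
theorem Cex.caseA {w p q : List Bool} (h : Cex w p q)
    (hup : ∀ l r : List Bool, w = l ++ p ++ r → l = [])
    (huq : ∀ l r : List Bool, w = l ++ q ++ r → r = []) : False := by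
  have hlt := h.lt
  obtain ⟨e, Q, β, p'', hw, hQ, hlen, hp, hrs⟩ := h.step
  have hpal := h.hp.pal
  have : w.length ≤ p.length + q.length := by
    refine lemI h.t ?_ h.hq.suf huq
    intro u hu hru
    cases u with
    | nil => rw [hp] at hu; simp at hu
    | cons y u' =>
      have : u' = p''.reverse := by
        refine h.t.rs _ _ ?_ (hru.drop (List.suffix_cons _ _)) hrs
        rw [hp] at hu; simpa using hu
      subst this
      obtain ⟨l, r, hlr⟩ := hru e
      have := hup (l ++ [y]) r (by
        rw [← hlr, ← hpal, hp]; simp)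
      simp at this
  omega

/-- case B: `w = p s p` -/
theorem Cex.caseB {w p : List Bool} (h : Cex w p p)
    (hocc : ∀ l r : List Bool, w = l ++ p ++ r → l = [] ∨ r = []) : False := by
  have hlt := h.lt
  have hpal := h.hp.pal
  have hpp := h.p_pos
  obtain ⟨e, Q, β, p'', hw, hQ, hlen, hp, hrs⟩ := h.step
  have hls : LS w p'' := by
    obtain ⟨e', Q', β', p2, -, -, -, hp2, hrs2⟩ := h.rev.step
    rw [hp] at hp2
    have hh : p'' = p2 := by simpa using (List.cons.inj hp2).2
    rw [RS_reverse, List.reverse_reverse, ← hh] at hrs2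
    exact hrs2
  have hpal2 : p''.reverse ++ [e] = p := by rw [← hpal, hp]; simp
  obtain ⟨s1, hs1⟩ := h.hp.pre
  obtain ⟨s2, hs2⟩ := h.hq.suf
  -- |w| ≥ 2|p|+2
  have hlen2 : 2 * p.length + 2 ≤ w.length := by
    by_contra hcon
    have hl : w.length = 2 * p.length + 1 := by omega
    have hl1 : p.length < s2.length := by
      have := congrArg List.length hs2; simp at this; omega
    obtain ⟨x, hx⟩ := List.prefix_of_prefix_length_le (⟨s1, hs1⟩ : p <+: w) ⟨p, hs2⟩ hl1.le
    have hx1 : x.length = 1 := by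
      have h1 := congrArg List.length hs2
      have h2 := congrArg List.length hx
      simp at h1 h2; omega
    obtain ⟨c, rfl⟩ := List.length_eq_one_iff.1 hx1
    have hwp : w.reverse = w := by
      rw [← hs2, ← hx]; simp [hpal]
    have := h.hp.max w List.prefix_rfl hwp
    omega
  -- existence of a right special factor r of length |w|-|p|-2
  obtain ⟨r, hrl, hr⟩ : ∃ r : List Bool, r.length + p.length + 2 = w.length ∧ RS w r := by
    by_contra hno
    push Not at hno
    rcases List.eq_nil_or_concat s2 with rfl | ⟨s3, y, rfl⟩
    · simp at hs2; rw [hs2] at hlt; omega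
    have := lemI (n := w.length - p.length - 2) (q := y :: p) h.t
      (fun u hu => hno u (by omega)) ⟨s3, by rw [← hs2]; simp⟩ (by
        intro l r hlr
        rcases hocc (l ++ [y]) r (by rw [hlr]; simp) with h1 | h1
        · simp at h1
        · exact h1)
    simp at this
    omega
  have hmaxR : ∀ u : List Bool, u.length = r.length + 1 → ¬ RS w u := by
    intro u hu hru
    have := lemII hru h.hq.suf ⟨[], s1, by simp [hs1], by
      rintro rfl
      simp at hs1; rw [hs1] at hlt; omega⟩
    omega
  -- r is left special
  have hext : ∀ x : Bool, ∃ y : Bool, y :: r ++ [x] <:+: w := by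
    intro x
    obtain ⟨l, t, hlt1⟩ := hr x
    rcases List.eq_nil_or_concat l with rfl | ⟨l, y, rfl⟩
    · exfalso
      have hrw : r <+: w := ⟨[x] ++ t, by rw [← hlt1]; simp⟩
      obtain ⟨r', hr'⟩ := List.prefix_of_prefix_length_le h.hp.pre hrw (by omega)
      obtain ⟨l2, t2, hlt2⟩ := hr (!x)
      rcases hocc l2 (r' ++ [!x] ++ t2) (by rw [← hlt2, ← hr']; simp) with h1 | h1
      · subst h1
        rw [← hlt1] at hlt2
        simp at hlt2
      · simp at h1
    · exact ⟨y, l, t, by rw [← hlt1]; simp⟩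
  have hLr : LS w r := by
    obtain ⟨y1, hy1⟩ := hext true
    obtain ⟨y2, hy2⟩ := hext false
    have hne : y1 ≠ y2 := by
      rintro rfl
      refine hmaxR (y1 :: r) (by simp) ?_
      intro x
      cases x
      · exact hy2
      · exact hy1
    intro z
    have hz : z = y1 ∨ z = y2 := by
      clear * - hne
      revert y1 y2 z
      decide
    rcases hz with rfl | rfl
    · exact (List.prefix_append _ _).isInfix.trans hy1
    · exact (List.prefix_append _ _).isInfix.trans hy2
  have hpl : p.length = p''.length + 1 := by rw [hp]; simp
  obtain ⟨r1, hr1⟩ : p'' <+: r := by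
    have : p'' = r.take p''.length :=
      h.t.ls _ _ (by rw [List.length_take]; omega) hls (hLr.take (List.take_prefix _ _))
    rw [this]; exact List.take_prefix _ _
  obtain ⟨r2, hr2⟩ : p''.reverse <:+ r := by
    have : p''.reverse = r.drop (r.length - p''.length) :=
      h.t.rs _ _ (by simp; omega) hrs (hr.drop (List.drop_suffix _ _))
    rw [this]; exact List.drop_suffix _ _
  -- e r x is a prefix
  have hepre : ∀ x : Bool, e :: r ++ [x] <:+: w → x = !e ∧ e :: r ++ [x] <+: w := by
    rintro x ⟨l, t, hlt1⟩
    have hl0 : l = [] := by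
      rcases hocc l (r1 ++ [x] ++ t) (by rw [← hlt1, ← hr1, hp]; simp) with h1 | h1
      · exact h1
      · simp at h1
    subst hl0
    refine ⟨?_, ⟨t, by simpa using hlt1⟩⟩
    apply bnot
    rintro rfl
    have := hocc (x :: r2) t (by rw [← hlt1, ← hr2, ← hpal2]; simp)
    rcases this with h1 | h1
    · simp at h1
    · subst h1
      have := congrArg List.length hlt1
      simp at this
      omega
  have hyes : (e :: r ++ [!e] <+: w) ∧ ((!e) :: r ++ [e] <:+: w) := by
    obtain ⟨y1, hy1⟩ := hext e
    obtain ⟨y2, hy2⟩ := hext (!e)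
    have h1 : y1 = !e := by
      apply bnot
      rintro rfl
      have := (hepre _ hy1).1
      simp at this
    subst h1
    have h2 : y2 = e := by
      by_contra h2
      have := bnot h2
      subst this
      refine hmaxR ((!e) :: r) (by simp) ?_
      intro x
      by_cases hx : x = e
      · subst hx; exact hy1
      · rw [bnot hx]; exact hy2
    subst h2
    exact ⟨(hepre _ hy2).2, hy1⟩
  obtain ⟨hy1, hy2⟩ := hyes
  -- the reversal
  have hrQ : r ++ [!e] <+: Q := by
    have h1 : r ++ [!e] <+: Q ++ (!e) :: β := by
      rw [hw] at hy1
      simpa using hy1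
    exact List.prefix_of_prefix_length_le h1 (List.prefix_append _ _) (by simp; omega)
  have hrev : (!e) :: r.reverse ++ [!e] <:+: w := by
    obtain ⟨t, ht⟩ := hrQ
    have : Q = t.reverse ++ (!e) :: r.reverse := by
      rw [← hQ, ← ht]; simp
    exact ⟨e :: t.reverse, β, by rw [hw, this]; simp⟩
  have mkRS : ∀ g : List Bool, ∀ x : Bool, g ++ [x] <:+: w → g ++ [!x] <:+: w → RS w g := by
    intro g x h1 h2 z
    by_cases hz : z = x
    · rw [hz]; exact h1
    · rw [bnot hz]; exact h2
  by_cases hrr : r = r.reverse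
  · rw [← hrr] at hrev
    exact hmaxR ((!e) :: r) (by simp) (mkRS _ e hy2 hrev)
  obtain ⟨g, a, b, f, ha, hb⟩ := common_pre_split r r.reverse (by simp) hrr
  have ha' : r.reverse = a.reverse ++ f :: g.reverse := by rw [ha]; simp
  have hb' : r = b.reverse ++ (!f) :: g.reverse := by
    rw [← List.reverse_reverse r, hb]; simp
  have tr : ∀ {u v : List Bool}, v <:+: w → u <:+: v → u <:+: w := fun h1 h2 => h2.trans h1
  have i1 : e :: g ++ [f] <:+: w := tr hy1.isInfix ⟨[], a ++ [!e], by rw [ha]; simp⟩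
  have i2 : (!e) :: g ++ [f] <:+: w := tr hy2 ⟨[], a ++ [e], by rw [ha]; simp⟩
  have i3 : (!e) :: g ++ [!f] <:+: w := tr hrev ⟨[], b ++ [!e], by rw [hb]; simp⟩
  have hRg : RS w ((!e) :: g) := mkRS _ f i2 i3
  have hg : g = g.reverse := by
    refine h.t.rs _ _ (by simp) (hRg.drop (List.suffix_cons _ _)) (hr.drop ?_)
    exact ⟨b.reverse ++ [!f], by rw [hb']; simp⟩
  rw [← hg] at ha' hb'
  have i4 : f :: g ++ [!e] <:+: w := tr hrev ⟨(!e) :: a.reverse, [], by rw [ha']; simp⟩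
  have i5 : (!f) :: g ++ [!e] <:+: w := tr hy1.isInfix ⟨e :: b.reverse, [], by rw [hb']; simp⟩
  have i6 : (!f) :: g ++ [e] <:+: w := tr hy2 ⟨(!e) :: b.reverse, [], by rw [hb']; simp⟩
  have hfe := h.t.rs _ _ (by simp) hRg (mkRS _ e i6 i5)
  have hfe' : f = e := by
    have := (List.cons.inj hfe).1
    clear * - this
    revert f e
    decide
  subst hfe'
  have := h.t.rs _ _ (by simp) hRg (mkRS (f :: g) f i1 i4)
  simp at this

theorem main (n : ℕ) : ∀ w p q : List Bool, w.length = n → T w → LPP w p → LPS w q →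
    w.length ≤ p.length + q.length := by
  induction n using Nat.strong_induction_on with
  | _ n ih =>
    intro w p q hn ht hp hq
    by_contra hlt
    have hc : Cex w p q := ⟨ht, hp, hq, by omega,
      fun v p' q' hv ht' h1 h2 => ih v.length (by omega) v p' q' rfl ht' h1 h2⟩
    rcases hc.occ with h1 | ⟨rfl, h1⟩
    · rcases hc.rev.occ with h2 | ⟨rfl, h2⟩
      · refine hc.caseA h1 ?_
        intro l r hlr
        have := h2 r.reverse l.reverse (by rw [hlr]; simp [hq.pal])
        simpa using this
      · obtain ⟨l, hl⟩ := hq.suf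
        have := h1 l [] (by simp [hl])
        subst this
        simp at hl
        rw [hl] at hlt
        omega
    · exact hc.caseB h1

end GTW

theorem stmt13 (w : List A) (hw : IsGT w) (h2 : (Alph w).card = 2)
    (p q : List A)
    (hp : p <+: w) (hppal : p.reverse = p)
    (hpmax : ∀ p' : List A, p' <+: w → p'.reverse = p' → p'.length ≤ p.length)
    (hq : q <:+ w) (hqpal : q.reverse = q)
    (hqmax : ∀ q' : List A, q' <:+ w → q'.reverse = q' → q'.length ≤ q.length) :
    w.length ≤ p.length + q.length := by
  obtain ⟨a, b, hab, hAl⟩ := Finset.card_eq_two.1 h2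
  set g : Bool → A := fun x => if x then a else b with hg
  have hginj : Function.Injective g := by
    intro x y hxy
    cases x <;> cases y
    · rfl
    · exact absurd (by simpa [hg] using hxy.symm) hab
    · exact absurd (by simpa [hg] using hxy) hab
    · rfl
  have hmem : ∀ x ∈ w, x = a ∨ x = b := by
    intro x hx
    have : x ∈ Alph w := by simpa [Alph] using hx
    rw [hAl] at this
    simpa using this
  obtain ⟨v, rfl⟩ : ∃ v : List Bool, w = v.map g := by
    refine ⟨w.map (fun x => decide (x = a)), ?_⟩
    rw [List.map_map]
    conv_lhs => rw [← List.map_id w]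
    apply List.map_congr_left
    intro x hx
    rcases hmem x hx with rfl | rfl
    · simp [hg]
    · simp [hg, hab.symm]
  have hC : ∀ i, C v (i+1) ≤ C v i + 1 := by
    have hc1 : ∀ i, C (v.map g) i = C v i := fun i => GTW.C_map g hginj v i
    rcases hw.2 with h1 | ⟨m, M, hm, hmM, hA, hB, hD⟩
    · omega
    · rw [h2] at hA
      simp only [hc1] at hA hB hD
      intro i
      rcases Nat.eq_zero_or_pos i with rfl | hi
      · have := hA 1 le_rfl hm
        rw [GTW.C_zero, this]
      · rcases Nat.lt_or_ge i m with h | h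
        · have e1 := hA i hi h.le
          have e2 := hA (i+1) (by omega) h
          omega
        · rcases Nat.lt_or_ge i M with h' | h'
          · have := hB i h (by omega)
            omega
          · rcases Nat.lt_or_ge v.length i with h3 | h3
            · have := GTW.C_big v (i+1) (by omega)
              omega
            · have := hD i h' (by simpa using h3)
              omega
  obtain ⟨t, ht⟩ := hp
  obtain ⟨s, hs⟩ := hq
  obtain ⟨p1, t1, hv1, rfl, rfl⟩ := List.map_eq_append_iff.1 ht.symm
  obtain ⟨s1, q1, hv2, rfl, rfl⟩ := List.map_eq_append_iff.1 hs.symm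
  have hinj := List.map_injective_iff.2 hginj
  have := GTW.main v.length v p1 q1 rfl (GTW.T_of_C hC)
    ⟨⟨t1, hv1.symm⟩, hinj (by rw [List.map_reverse]; exact hppal), fun p' h1 h2 => by
      have := hpmax (p'.map g) (h1.map g) (by rw [← List.map_reverse, h2])
      simpa using this⟩
    ⟨⟨s1, hv2.symm⟩, hinj (by rw [List.map_reverse]; exact hqpal), fun p' h1 h2 => by
      have := hqmax (p'.map g) (h1.map g) (by rw [← List.map_reverse, h2])
      simpa using this⟩
  simpa using this
end
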